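/- arXiv:2303.16806 — 2 statements merged into one kernel-verified Lean document; each statement's English description precedes it below -/
import Mathlib

section
/- For a 2-player stage game G in which both players may only use pure strategies (in the stage game and in all repeated games), there exist some T ≥ 1 and some subgame-perfect equilibrium of the repeated game G(T) in which local suboptimality occurs if and only if at least one of the following holds: (1) |V₁^{p,p}| > 1, |V₂^{p,p}| > 1, and there exist â₁ ∈ A₁, â₂ ∈ A₂ with (â₁, â₂) ∉ Nash^{p,p}(G); OR (2) |V₁^{p,p}| > 1, |V₂^{p,p}| = 1, and there exist â₁, a₁′ ∈ A₁ and â₂ ∈ A₂ with u₁(â₁, â₂) < u₁(a₁′, â₂) and â₂ a best response (among pure strategies) to â₁; OR (3) |V₁^{p,p}| = 1, |V₂^{p,p}| > 1, and there exist â₁ ∈ A₁ and â₂, a₂′ ∈ A₂ with u₂(â₁, â₂) < u₂(â₁, a₂′) and â₁ a best response (among pure strategies) to â₂. -/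
open Finset

/-- A mixed strategy on a finite action set: a probability distribution. -/
structure Mix (A : Type*) [Fintype A] where
  p : A → ℝ
  nonneg : ∀ a, 0 ≤ p a
  sum_one : ∑ a, p a = 1

namespace Mix

/-- The Dirac (pure) mixed strategy at an action. -/
def pure {A : Type*} [Fintype A] [DecidableEq A] (a : A) : Mix A where
  p := fun b => if b = a then 1 else 0
  nonneg := by intro b; by_cases hb : b = a <;> simp [hb]
  sum_one := by simp

/-- The support of a mixed strategy. -/
def support {A : Type*} [Fintype A] (σ : Mix A) : Set A := {a | 0 < σ.p a}

end Mix

section TwoPlayer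

variable {A₁ A₂ : Type*} [Fintype A₁] [Fintype A₂] [DecidableEq A₁] [DecidableEq A₂]

/-- Expected payoff under a mixed strategy profile. -/
def expPay (u : A₁ → A₂ → ℝ) (σ₁ : Mix A₁) (σ₂ : Mix A₂) : ℝ :=
  ∑ a₁, ∑ a₂, σ₁.p a₁ * σ₂.p a₂ * u a₁ a₂

/-- Player 1's pure action `a₁` is a best response among pure strategies to `a₂`. -/
def BR1p (u₁ : A₁ → A₂ → ℝ) (a₁ : A₁) (a₂ : A₂) : Prop := ∀ b₁, u₁ b₁ a₂ ≤ u₁ a₁ a₂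

/-- Player 2's pure action `a₂` is a best response among pure strategies to `a₁`. -/
def BR2p (u₂ : A₁ → A₂ → ℝ) (a₁ : A₁) (a₂ : A₂) : Prop := ∀ b₂, u₂ a₁ b₂ ≤ u₂ a₁ a₂

/-- Player 1's mixed strategy `σ₁` is a best response (among mixed strategies) to `σ₂`. -/
def BR1m (u₁ : A₁ → A₂ → ℝ) (σ₁ : Mix A₁) (σ₂ : Mix A₂) : Prop :=
  ∀ τ₁ : Mix A₁, expPay u₁ τ₁ σ₂ ≤ expPay u₁ σ₁ σ₂

/-- Player 2's mixed strategy `σ₂` is a best response (among mixed strategies) to `σ₁`. -/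
def BR2m (u₂ : A₁ → A₂ → ℝ) (σ₁ : Mix A₁) (σ₂ : Mix A₂) : Prop :=
  ∀ τ₂ : Mix A₂, expPay u₂ σ₁ τ₂ ≤ expPay u₂ σ₁ σ₂

/-- Player 2's pure action `a₂` is a best response among pure strategies to mixed `σ₁`. -/
def BR2pm (u₂ : A₁ → A₂ → ℝ) (σ₁ : Mix A₁) (a₂ : A₂) : Prop :=
  ∀ b₂ : A₂, expPay u₂ σ₁ (Mix.pure b₂) ≤ expPay u₂ σ₁ (Mix.pure a₂)

/-- Pure Nash equilibria (both players restricted to pure strategies). -/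
def NashPP (u₁ u₂ : A₁ → A₂ → ℝ) : Set (A₁ × A₂) :=
  {q | BR1p u₁ q.1 q.2 ∧ BR2p u₂ q.1 q.2}

/-- Nash equilibria when player 1 is mixed and player 2 is pure. -/
def NashMP (u₁ u₂ : A₁ → A₂ → ℝ) : Set (Mix A₁ × A₂) :=
  {q | BR1m u₁ q.1 (Mix.pure q.2) ∧ BR2pm u₂ q.1 q.2}

/-- Mixed Nash equilibria. -/
def NashMM (u₁ u₂ : A₁ → A₂ → ℝ) : Set (Mix A₁ × Mix A₂) :=
  {q | BR1m u₁ q.1 q.2 ∧ BR2m u₂ q.1 q.2}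

def V1pp (u₁ u₂ : A₁ → A₂ → ℝ) : Set ℝ := (fun q => u₁ q.1 q.2) '' NashPP u₁ u₂
def V2pp (u₁ u₂ : A₁ → A₂ → ℝ) : Set ℝ := (fun q => u₂ q.1 q.2) '' NashPP u₁ u₂
def V1mp (u₁ u₂ : A₁ → A₂ → ℝ) : Set ℝ :=
  (fun q => expPay u₁ q.1 (Mix.pure q.2)) '' NashMP u₁ u₂
def V2mp (u₁ u₂ : A₁ → A₂ → ℝ) : Set ℝ :=
  (fun q => expPay u₂ q.1 (Mix.pure q.2)) '' NashMP u₁ u₂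
def V1mm (u₁ u₂ : A₁ → A₂ → ℝ) : Set ℝ := (fun q => expPay u₁ q.1 q.2) '' NashMM u₁ u₂
def V2mm (u₁ u₂ : A₁ → A₂ → ℝ) : Set ℝ := (fun q => expPay u₂ q.1 q.2) '' NashMM u₁ u₂

/-- The set `V` is a singleton, i.e. `|V| = 1`. -/
def oneVal (V : Set ℝ) : Prop := ∃ v, V = {v}

/-- A history of play: a finite sequence of pure action profiles. -/
abbrev Hist (A₁ A₂ : Type*) := List (A₁ × A₂)

/-- A pure behavior strategy for player 1, seen as a mixed behavior strategy. -/
def pureBeh1 (μ : Hist A₁ A₂ → A₁) : Hist A₁ A₂ → Mix A₁ := fun h => Mix.pure (μ h)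

/-- A pure behavior strategy for player 2, seen as a mixed behavior strategy. -/
def pureBeh2 (μ : Hist A₁ A₂ → A₂) : Hist A₁ A₂ → Mix A₂ := fun h => Mix.pure (μ h)

/-- Expected total payoff (w.r.t. `u`) over `T` remaining rounds, after history `h`. -/
def totPay (u : A₁ → A₂ → ℝ) (μ₁ : Hist A₁ A₂ → Mix A₁) (μ₂ : Hist A₁ A₂ → Mix A₂) :
    ℕ → Hist A₁ A₂ → ℝ
  | 0, _ => 0
  | T + 1, h =>
      ∑ a₁, ∑ a₂, (μ₁ h).p a₁ * (μ₂ h).p a₂ * (u a₁ a₂ + totPay u μ₁ μ₂ T (h ++ [(a₁, a₂)]))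

/-- The behavior strategy induced on the subgame following history `h`. -/
def condS {A₁ A₂ α : Type*} (μ : Hist A₁ A₂ → α) (h : Hist A₁ A₂) : Hist A₁ A₂ → α :=
  fun h' => μ (h ++ h')

/-- Nash equilibrium of the `T`-round repeated game, both players mixed. -/
def isNEmm (u₁ u₂ : A₁ → A₂ → ℝ) (T : ℕ)
    (μ₁ : Hist A₁ A₂ → Mix A₁) (μ₂ : Hist A₁ A₂ → Mix A₂) : Prop :=
  (∀ μ₁' : Hist A₁ A₂ → Mix A₁, totPay u₁ μ₁' μ₂ T [] ≤ totPay u₁ μ₁ μ₂ T []) ∧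
  (∀ μ₂' : Hist A₁ A₂ → Mix A₂, totPay u₂ μ₁ μ₂' T [] ≤ totPay u₂ μ₁ μ₂ T [])

/-- Subgame-perfect equilibrium of the `T`-round repeated game, both players mixed. -/
def isSPEmm (u₁ u₂ : A₁ → A₂ → ℝ) (T : ℕ)
    (μ₁ : Hist A₁ A₂ → Mix A₁) (μ₂ : Hist A₁ A₂ → Mix A₂) : Prop :=
  ∀ h : Hist A₁ A₂, h.length < T → isNEmm u₁ u₂ (T - h.length) (condS μ₁ h) (condS μ₂ h)

/-- Nash equilibrium of the `T`-round repeated game, player 1 mixed and player 2 pure. -/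
def isNEmp (u₁ u₂ : A₁ → A₂ → ℝ) (T : ℕ)
    (μ₁ : Hist A₁ A₂ → Mix A₁) (μ₂ : Hist A₁ A₂ → A₂) : Prop :=
  (∀ μ₁' : Hist A₁ A₂ → Mix A₁,
      totPay u₁ μ₁' (pureBeh2 μ₂) T [] ≤ totPay u₁ μ₁ (pureBeh2 μ₂) T []) ∧
  (∀ μ₂' : Hist A₁ A₂ → A₂,
      totPay u₂ μ₁ (pureBeh2 μ₂') T [] ≤ totPay u₂ μ₁ (pureBeh2 μ₂) T [])

/-- SPE of the `T`-round repeated game, player 1 mixed and player 2 pure. -/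
def isSPEmp (u₁ u₂ : A₁ → A₂ → ℝ) (T : ℕ)
    (μ₁ : Hist A₁ A₂ → Mix A₁) (μ₂ : Hist A₁ A₂ → A₂) : Prop :=
  ∀ h : Hist A₁ A₂, h.length < T → isNEmp u₁ u₂ (T - h.length) (condS μ₁ h) (condS μ₂ h)

/-- Nash equilibrium of the `T`-round repeated game, both players pure. -/
def isNEpp (u₁ u₂ : A₁ → A₂ → ℝ) (T : ℕ)
    (μ₁ : Hist A₁ A₂ → A₁) (μ₂ : Hist A₁ A₂ → A₂) : Prop :=
  (∀ μ₁' : Hist A₁ A₂ → A₁,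
      totPay u₁ (pureBeh1 μ₁') (pureBeh2 μ₂) T [] ≤
        totPay u₁ (pureBeh1 μ₁) (pureBeh2 μ₂) T []) ∧
  (∀ μ₂' : Hist A₁ A₂ → A₂,
      totPay u₂ (pureBeh1 μ₁) (pureBeh2 μ₂') T [] ≤
        totPay u₂ (pureBeh1 μ₁) (pureBeh2 μ₂) T [])

/-- SPE of the `T`-round repeated game, both players pure. -/
def isSPEpp (u₁ u₂ : A₁ → A₂ → ℝ) (T : ℕ)
    (μ₁ : Hist A₁ A₂ → A₁) (μ₂ : Hist A₁ A₂ → A₂) : Prop :=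
  ∀ h : Hist A₁ A₂, h.length < T → isNEpp u₁ u₂ (T - h.length) (condS μ₁ h) (condS μ₂ h)

/-- `G ∈ 𝒢_LS^{p,p}`: local suboptimality occurs in some SPE of some `G(T)`,
both players restricted to pure strategies. -/
def GLSpp (u₁ u₂ : A₁ → A₂ → ℝ) : Prop :=
  ∃ T : ℕ, 1 ≤ T ∧ ∃ (μ₁ : Hist A₁ A₂ → A₁) (μ₂ : Hist A₁ A₂ → A₂),
    isSPEpp u₁ u₂ T μ₁ μ₂ ∧ ∃ h : Hist A₁ A₂, h.length < T ∧ (μ₁ h, μ₂ h) ∉ NashPP u₁ u₂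

/-- `G ∈ 𝒢_LS^{m,p}`: local suboptimality occurs in some SPE of some `G(T)`,
player 1 mixed and player 2 pure. -/
def GLSmp (u₁ u₂ : A₁ → A₂ → ℝ) : Prop :=
  ∃ T : ℕ, 1 ≤ T ∧ ∃ (μ₁ : Hist A₁ A₂ → Mix A₁) (μ₂ : Hist A₁ A₂ → A₂),
    isSPEmp u₁ u₂ T μ₁ μ₂ ∧ ∃ h : Hist A₁ A₂, h.length < T ∧ (μ₁ h, μ₂ h) ∉ NashMP u₁ u₂

/-- `G ∈ 𝒢_LS^{m,m}`: local suboptimality occurs in some SPE of some `G(T)`,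
both players mixed. -/
def GLSmm (u₁ u₂ : A₁ → A₂ → ℝ) : Prop :=
  ∃ T : ℕ, 1 ≤ T ∧ ∃ (μ₁ : Hist A₁ A₂ → Mix A₁) (μ₂ : Hist A₁ A₂ → Mix A₂),
    isSPEmm u₁ u₂ T μ₁ μ₂ ∧ ∃ h : Hist A₁ A₂, h.length < T ∧ (μ₁ h, μ₂ h) ∉ NashMM u₁ u₂

/-- The pure-pure characterization condition (condition of the pure-strategy theorem). -/
def condPP (u₁ u₂ : A₁ → A₂ → ℝ) : Prop :=
  ((V1pp u₁ u₂).Nontrivial ∧ (V2pp u₁ u₂).Nontrivial ∧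
    ∃ (a₁ : A₁) (a₂ : A₂), (a₁, a₂) ∉ NashPP u₁ u₂) ∨
  ((V1pp u₁ u₂).Nontrivial ∧ oneVal (V2pp u₁ u₂) ∧
    ∃ (a₁ a₁' : A₁) (a₂ : A₂), u₁ a₁ a₂ < u₁ a₁' a₂ ∧ BR2p u₂ a₁ a₂) ∨
  (oneVal (V1pp u₁ u₂) ∧ (V2pp u₁ u₂).Nontrivial ∧
    ∃ (a₁ : A₁) (a₂ a₂' : A₂), u₂ a₁ a₂ < u₂ a₁ a₂' ∧ BR1p u₁ a₁ a₂)

/-- The mixed-mixed characterization condition (condition of the general-case theorem). -/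
def condMM (u₁ u₂ : A₁ → A₂ → ℝ) : Prop :=
  ((V1mm u₁ u₂).Nontrivial ∧ (V2mm u₁ u₂).Nontrivial ∧
    ∃ (σ₁ : Mix A₁) (σ₂ : Mix A₂), (σ₁, σ₂) ∉ NashMM u₁ u₂) ∨
  ((V1mm u₁ u₂).Nontrivial ∧ oneVal (V2mm u₁ u₂) ∧
    ∃ (σ₁ : Mix A₁) (σ₂ : Mix A₂) (a₁' : A₁),
      expPay u₁ σ₁ σ₂ < expPay u₁ (Mix.pure a₁') σ₂ ∧ BR2m u₂ σ₁ σ₂) ∨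
  (oneVal (V1mm u₁ u₂) ∧ (V2mm u₁ u₂).Nontrivial ∧
    ∃ (σ₁ : Mix A₁) (σ₂ : Mix A₂) (a₂' : A₂),
      expPay u₂ σ₁ σ₂ < expPay u₂ σ₁ (Mix.pure a₂') ∧ BR1m u₁ σ₁ σ₂)

/-- The set `D` of differences of player 1's payoffs between pairs of stage-game
Nash equilibria (mixed-pure case). -/
def Dmp (u₁ u₂ : A₁ → A₂ → ℝ) : Set ℝ :=
  {x | ∃ q ∈ NashMP u₁ u₂, ∃ q' ∈ NashMP u₁ u₂,
    x = expPay u₁ q.1 (Mix.pure q.2) - expPay u₁ q'.1 (Mix.pure q'.2)}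

/-- `x` is a finite (possibly empty) sum of elements of `D`. -/
def sumOfD (D : Set ℝ) (x : ℝ) : Prop :=
  ∃ (n : ℕ) (d : Fin n → ℝ), (∀ k, d k ∈ D) ∧ x = ∑ k, d k

/-- The mixed-pure characterization condition (condition of the
pure-strategy-against-mixed-strategy theorem). -/
def condMP (u₁ u₂ : A₁ → A₂ → ℝ) : Prop :=
  ((V1mp u₁ u₂).Nontrivial ∧ (V2mp u₁ u₂).Nontrivial ∧
    ∃ (σ₁ : Mix A₁) (a₂ : A₂), (σ₁, a₂) ∉ NashMP u₁ u₂) ∨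
  ((V1mp u₁ u₂).Nontrivial ∧ oneVal (V2mp u₁ u₂) ∧
    ∃ (σ₁ : Mix A₁) (a₁' : A₁) (a₂ : A₂),
      expPay u₁ σ₁ (Mix.pure a₂) < u₁ a₁' a₂ ∧
      BR2pm u₂ σ₁ a₂ ∧
      (σ₁.support.Nontrivial →
        ∃ a ∈ σ₁.support, ∀ a' ∈ σ₁.support, a' ≠ a →
          sumOfD (Dmp u₁ u₂) (u₁ a a₂ - u₁ a' a₂))) ∨
  (oneVal (V1mp u₁ u₂) ∧ (V2mp u₁ u₂).Nontrivial ∧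
    ∃ (σ₁ : Mix A₁) (a₂ a₂' : A₂),
      expPay u₂ σ₁ (Mix.pure a₂) < expPay u₂ σ₁ (Mix.pure a₂') ∧
      BR1m u₁ σ₁ (Mix.pure a₂))

/-- A history is reachable under the behavior profile `(μ₁, μ₂)` (mixed-pure case):
every action of player 1 along it has positive probability and every action of
player 2 along it is the prescribed one. -/
def reachableMP (μ₁ : Hist A₁ A₂ → Mix A₁) (μ₂ : Hist A₁ A₂ → A₂) (h : Hist A₁ A₂) : Prop :=
  ∀ k : Fin h.length, 0 < (μ₁ (h.take k.val)).p (h.get k).1 ∧ μ₂ (h.take k.val) = (h.get k).2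

end TwoPlayer

section OneShotDeviation

variable {A₁ A₂ : Type*} [Fintype A₁] [Fintype A₂] [DecidableEq A₁] [DecidableEq A₂]

/-- Total payoff of a pure strategy profile over `n` further rounds after a history. -/
def purePay (u : A₁ → A₂ → ℝ) (μ₁ : Hist A₁ A₂ → A₁) (μ₂ : Hist A₁ A₂ → A₂) (n : ℕ)
    (h : Hist A₁ A₂) : ℝ :=
  totPay u (pureBeh1 μ₁) (pureBeh2 μ₂) n h

theorem purePay_zero (u : A₁ → A₂ → ℝ) (μ₁ : Hist A₁ A₂ → A₁) (μ₂ : Hist A₁ A₂ → A₂)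
    (h : Hist A₁ A₂) : purePay u μ₁ μ₂ 0 h = 0 := rfl

theorem purePay_succ (u : A₁ → A₂ → ℝ) (μ₁ : Hist A₁ A₂ → A₁) (μ₂ : Hist A₁ A₂ → A₂) (n : ℕ)
    (h : Hist A₁ A₂) :
    purePay u μ₁ μ₂ (n + 1) h =
      u (μ₁ h) (μ₂ h) + purePay u μ₁ μ₂ n (h ++ [(μ₁ h, μ₂ h)]) := by
  simp [purePay, totPay, pureBeh1, pureBeh2, Mix.pure]

theorem purePay_condS (u : A₁ → A₂ → ℝ) (μ₁ : Hist A₁ A₂ → A₁) (μ₂ : Hist A₁ A₂ → A₂)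
    (h : Hist A₁ A₂) (n : ℕ) (g : Hist A₁ A₂) :
    purePay u (condS μ₁ h) (condS μ₂ h) n g = purePay u μ₁ μ₂ n (h ++ g) := by
  induction n generalizing g with
  | zero => rfl
  | succ n ih => rw [purePay_succ, purePay_succ, ih]; simp [condS]

/-- The payoff depends only on the strategies at histories at least as long as the current one. -/
theorem purePay_congr (u : A₁ → A₂ → ℝ) {μ₁ ν₁ : Hist A₁ A₂ → A₁} {μ₂ ν₂ : Hist A₁ A₂ → A₂}
    (n : ℕ) (g : Hist A₁ A₂) (h₁ : ∀ f, g.length ≤ f.length → μ₁ f = ν₁ f)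
    (h₂ : ∀ f, g.length ≤ f.length → μ₂ f = ν₂ f) :
    purePay u μ₁ μ₂ n g = purePay u ν₁ ν₂ n g := by
  induction n generalizing g with
  | zero => rfl
  | succ n ih =>
    rw [purePay_succ, purePay_succ, h₁ g le_rfl, h₂ g le_rfl, ih]
    · intro f hf
      exact h₁ f (by simp at hf; omega)
    · intro f hf
      exact h₂ f (by simp at hf; omega)

theorem purePay_eq_nsmul (u : A₁ → A₂ → ℝ) {μ₁ : Hist A₁ A₂ → A₁} {μ₂ : Hist A₁ A₂ → A₂}
    {v : ℝ} (n : ℕ) (g : Hist A₁ A₂)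
    (hv : ∀ f, g.length ≤ f.length → f.length < g.length + n → u (μ₁ f) (μ₂ f) = v) :
    purePay u μ₁ μ₂ n g = n • v := by
  induction n generalizing g with
  | zero => simp [purePay_zero]
  | succ n ih =>
    rw [purePay_succ, hv g le_rfl (by omega), ih, succ_nsmul, add_comm]
    intro f hf hf'
    simp at hf hf'
    exact hv f (by omega) (by omega)

/-- The stage game augmented by the continuation payoff over `n` further rounds. -/
def contGame (u : A₁ → A₂ → ℝ) (μ₁ : Hist A₁ A₂ → A₁) (μ₂ : Hist A₁ A₂ → A₂) (n : ℕ)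
    (h : Hist A₁ A₂) : A₁ → A₂ → ℝ :=
  fun a₁ a₂ => u a₁ a₂ + purePay u μ₁ μ₂ n (h ++ [(a₁, a₂)])

theorem purePay_deviation₁_le (u : A₁ → A₂ → ℝ) {T : ℕ} {μ₁ : Hist A₁ A₂ → A₁}
    {μ₂ : Hist A₁ A₂ → A₂}
    (hBR : ∀ h, h.length < T → BR1p (contGame u μ₁ μ₂ (T - h.length - 1) h) (μ₁ h) (μ₂ h))
    (ν₁ : Hist A₁ A₂ → A₁) (n : ℕ) (g : Hist A₁ A₂) (hg : g.length + n = T) :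
    purePay u ν₁ μ₂ n g ≤ purePay u μ₁ μ₂ n g := by
  induction n generalizing g with
  | zero => exact le_rfl
  | succ n ih =>
    rw [purePay_succ, purePay_succ]
    have h := hBR g (by omega) (ν₁ g)
    rw [show T - g.length - 1 = n by omega] at h
    have h' := ih (g ++ [(ν₁ g, μ₂ g)]) (by simp; omega)
    simp only [contGame] at h
    linarith

theorem purePay_deviation₂_le (u : A₁ → A₂ → ℝ) {T : ℕ} {μ₁ : Hist A₁ A₂ → A₁}
    {μ₂ : Hist A₁ A₂ → A₂}
    (hBR : ∀ h, h.length < T → BR2p (contGame u μ₁ μ₂ (T - h.length - 1) h) (μ₁ h) (μ₂ h))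
    (ν₂ : Hist A₁ A₂ → A₂) (n : ℕ) (g : Hist A₁ A₂) (hg : g.length + n = T) :
    purePay u μ₁ ν₂ n g ≤ purePay u μ₁ μ₂ n g := by
  induction n generalizing g with
  | zero => exact le_rfl
  | succ n ih =>
    rw [purePay_succ, purePay_succ]
    have h := hBR g (by omega) (ν₂ g)
    rw [show T - g.length - 1 = n by omega] at h
    have h' := ih (g ++ [(μ₁ g, ν₂ g)]) (by simp; omega)
    simp only [contGame] at h
    linarith

/-- One-shot deviation principle: a pure profile is subgame perfect iff after every history it
prescribes an equilibrium of the stage game augmented by continuation payoffs. -/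
theorem isSPEpp_iff (u₁ u₂ : A₁ → A₂ → ℝ) (T : ℕ) (μ₁ : Hist A₁ A₂ → A₁)
    (μ₂ : Hist A₁ A₂ → A₂) :
    isSPEpp u₁ u₂ T μ₁ μ₂ ↔ ∀ h, h.length < T →
      (μ₁ h, μ₂ h) ∈ NashPP (contGame u₁ μ₁ μ₂ (T - h.length - 1) h)
        (contGame u₂ μ₁ μ₂ (T - h.length - 1) h) := by
  constructor
  · intro hS h hT
    obtain ⟨n, hn⟩ : ∃ n, T - h.length = n + 1 := ⟨T - h.length - 1, by omega⟩
    obtain ⟨h₁, h₂⟩ := hS h hT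
    simp only [hn, Nat.add_sub_cancel]
    constructor
    · intro b
      have key := h₁ (Function.update (condS μ₁ h) [] b)
      change purePay _ _ _ _ _ ≤ purePay _ _ _ _ _ at key
      rw [hn, purePay_condS, List.append_nil, purePay_succ, purePay_succ,
        purePay_congr u₁ (ν₁ := condS μ₁ h) (ν₂ := condS μ₂ h) n _ _ (fun _ _ => rfl),
        purePay_condS] at key
      · simpa [contGame, condS] using key
      · intro f hf
        refine Function.update_of_ne ?_ _ _
        rintro rfl
        simp at hf
    · intro b
      have key := h₂ (Function.update (condS μ₂ h) [] b)
      change purePay _ _ _ _ _ ≤ purePay _ _ _ _ _ at key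
      rw [hn, purePay_condS, List.append_nil, purePay_succ, purePay_succ,
        purePay_congr u₂ (ν₁ := condS μ₁ h) (ν₂ := condS μ₂ h) n _ (fun _ _ => rfl) _,
        purePay_condS] at key
      · simpa [contGame, condS] using key
      · intro f hf
        refine Function.update_of_ne ?_ _ _
        rintro rfl
        simp at hf
  · intro hN h hT
    constructor
    · intro ν₁
      have key := purePay_deviation₁_le u₁ (fun h hT => (hN h hT).1)
        (fun g => ν₁ (g.drop h.length)) (T - h.length) (h ++ []) (by simp; omega)
      rw [← purePay_condS, ← purePay_condS] at key
      have hν : condS (fun g => ν₁ (g.drop h.length)) h = ν₁ := by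
        funext g
        simp [condS]
      rwa [hν] at key
    · intro ν₂
      have key := purePay_deviation₂_le u₂ (fun h hT => (hN h hT).2)
        (fun g => ν₂ (g.drop h.length)) (T - h.length) (h ++ []) (by simp; omega)
      rw [← purePay_condS, ← purePay_condS] at key
      have hν : condS (fun g => ν₂ (g.drop h.length)) h = ν₂ := by
        funext g
        simp [condS]
      rwa [hν] at key

end OneShotDeviation

section Necessity

variable {A₁ A₂ : Type*}

/-- A locally suboptimal history can be chosen of maximal length. -/
theorem exists_last_suboptimal {u₁ u₂ : A₁ → A₂ → ℝ} {T : ℕ} {μ₁ : Hist A₁ A₂ → A₁}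
    {μ₂ : Hist A₁ A₂ → A₂}
    (hex : ∃ h : Hist A₁ A₂, h.length < T ∧ (μ₁ h, μ₂ h) ∉ NashPP u₁ u₂) :
    ∃ h : Hist A₁ A₂, h.length < T ∧ (μ₁ h, μ₂ h) ∉ NashPP u₁ u₂ ∧
      ∀ f : Hist A₁ A₂, h.length < f.length → f.length < T → (μ₁ f, μ₂ f) ∈ NashPP u₁ u₂ := by
  obtain ⟨h, ⟨hT, hN⟩, hmin⟩ := WellFounded.has_min
    (InvImage.wf (fun h : Hist A₁ A₂ => T - h.length) Nat.lt_wfRel.wf)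
    {h | h.length < T ∧ (μ₁ h, μ₂ h) ∉ NashPP u₁ u₂} hex
  refine ⟨h, hT, hN, fun f hf hfT => ?_⟩
  by_contra hfN
  exact hmin f ⟨hfT, hfN⟩ (show T - f.length < T - h.length by omega)

variable [Fintype A₁] [Fintype A₂] [DecidableEq A₁] [DecidableEq A₂]

theorem nashPP_nonempty_of_isSPEpp [Nonempty A₁] [Nonempty A₂] {u₁ u₂ : A₁ → A₂ → ℝ} {T : ℕ}
    (hT : 1 ≤ T) {μ₁ : Hist A₁ A₂ → A₁} {μ₂ : Hist A₁ A₂ → A₂}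
    (hS : isSPEpp u₁ u₂ T μ₁ μ₂) : (NashPP u₁ u₂).Nonempty := by
  let h : Hist A₁ A₂ := List.replicate (T - 1) (Classical.arbitrary _)
  have hl : h.length = T - 1 := by simp [h]
  have key := (isSPEpp_iff u₁ u₂ T μ₁ μ₂).1 hS h (by omega)
  rw [show T - h.length - 1 = 0 by omega] at key
  refine ⟨(μ₁ h, μ₂ h), ?_⟩
  unfold contGame at key
  simpa only [purePay_zero, add_zero] using key

/-- If `u` is constant on equilibria and play is locally optimal after `h`, then continuation
payoffs do not depend on the actions chosen at `h`. -/
theorem contGame_eq_add_const {u₁ u₂ u : A₁ → A₂ → ℝ} {v : ℝ}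
    (hv : ∀ q ∈ NashPP u₁ u₂, u q.1 q.2 = v) {T : ℕ} {μ₁ : Hist A₁ A₂ → A₁}
    {μ₂ : Hist A₁ A₂ → A₂} {h : Hist A₁ A₂} (hT : h.length < T)
    (hlast : ∀ f : Hist A₁ A₂, h.length < f.length → f.length < T →
      (μ₁ f, μ₂ f) ∈ NashPP u₁ u₂) :
    contGame u μ₁ μ₂ (T - h.length - 1) h =
      fun a₁ a₂ => u a₁ a₂ + (T - h.length - 1) • v := by
  funext a₁ a₂
  rw [contGame, purePay_eq_nsmul]
  intro f hf hf'
  simp at hf hf'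
  exact hv _ (hlast f (by omega) (by omega))

theorem condPP_of_GLSpp [Nonempty A₁] [Nonempty A₂] {u₁ u₂ : A₁ → A₂ → ℝ}
    (hG : GLSpp u₁ u₂) : condPP u₁ u₂ := by
  obtain ⟨T, hT, μ₁, μ₂, hS, hex⟩ := hG
  have hne := nashPP_nonempty_of_isSPEpp hT hS
  obtain ⟨h, hhT, hhN, hlast⟩ := exists_last_suboptimal hex
  have hcont := (isSPEpp_iff u₁ u₂ T μ₁ μ₂).1 hS h hhT
  have br₁ : oneVal (V1pp u₁ u₂) → BR1p u₁ (μ₁ h) (μ₂ h) := by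
    rintro ⟨v, hv⟩ b
    have key := hcont.1 b
    rw [contGame_eq_add_const (v := v) (fun q hq => by
      have : u₁ q.1 q.2 ∈ V1pp u₁ u₂ := ⟨q, hq, rfl⟩
      rwa [hv] at this) hhT hlast] at key
    exact le_of_add_le_add_right key
  have br₂ : oneVal (V2pp u₁ u₂) → BR2p u₂ (μ₁ h) (μ₂ h) := by
    rintro ⟨v, hv⟩ b
    have key := hcont.2 b
    rw [contGame_eq_add_const (v := v) (fun q hq => by
      have : u₂ q.1 q.2 ∈ V2pp u₁ u₂ := ⟨q, hq, rfl⟩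
      rwa [hv] at this) hhT hlast] at key
    exact le_of_add_le_add_right key
  rcases (hne.image fun q => u₁ q.1 q.2).exists_eq_singleton_or_nontrivial with h₁ | h₁ <;>
    rcases (hne.image fun q => u₂ q.1 q.2).exists_eq_singleton_or_nontrivial with h₂ | h₂
  · exact absurd ⟨br₁ h₁, br₂ h₂⟩ hhN
  · have hn : ¬ BR2p u₂ (μ₁ h) (μ₂ h) := fun hb => hhN ⟨br₁ h₁, hb⟩
    simp only [BR2p, not_forall, not_le] at hn
    obtain ⟨b, hb⟩ := hn
    exact Or.inr (Or.inr ⟨h₁, h₂, _, _, b, hb, br₁ h₁⟩)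
  · have hn : ¬ BR1p u₁ (μ₁ h) (μ₂ h) := fun hb => hhN ⟨hb, br₂ h₂⟩
    simp only [BR1p, not_forall, not_le] at hn
    obtain ⟨b, hb⟩ := hn
    exact Or.inr (Or.inl ⟨h₁, h₂, _, b, _, hb, br₂ h₂⟩)
  · exact Or.inl ⟨h₁, h₂, _, _, hhN⟩

end Necessity

section Sufficiency

variable {A₁ A₂ : Type*} [Fintype A₁] [Fintype A₂] [DecidableEq A₁] [DecidableEq A₂]

/-- Play `a` in the first round; afterwards follow a sequence of profiles selected by the
first-round outcome. -/
def firstThen {α : Type*} (a : α) (c : A₁ × A₂ → ℕ → α) : Hist A₁ A₂ → α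
  | [] => a
  | b :: t => c b t.length

theorem purePay_firstThen (u : A₁ → A₂ → ℝ) (a : A₁ × A₂) (c : A₁ × A₂ → ℕ → A₁ × A₂) (n : ℕ)
    (b : A₁ × A₂) (t : Hist A₁ A₂) :
    purePay u (fun h => (firstThen a c h).1) (fun h => (firstThen a c h).2) n (b :: t) =
      ∑ k ∈ range n, u (c b (t.length + k)).1 (c b (t.length + k)).2 := by
  induction n generalizing t with
  | zero => simp [purePay_zero]
  | succ n ih =>
    rw [purePay_succ, sum_range_succ', List.cons_append, ih, add_comm]
    simp [firstThen, add_assoc, add_comm 1]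

/-- A non-equilibrium profile that becomes an equilibrium once outcome-dependent sequences of
stage equilibria are appended yields local suboptimality. -/
theorem GLSpp_of_continuation {u₁ u₂ : A₁ → A₂ → ℝ} (a : A₁ × A₂) (ha : a ∉ NashPP u₁ u₂)
    (K : ℕ) (c : A₁ × A₂ → ℕ → A₁ × A₂) (hc : ∀ b k, c b k ∈ NashPP u₁ u₂)
    (hN : a ∈ NashPP
      (fun b₁ b₂ => u₁ b₁ b₂ + ∑ k ∈ range K, u₁ (c (b₁, b₂) k).1 (c (b₁, b₂) k).2)
      (fun b₁ b₂ => u₂ b₁ b₂ + ∑ k ∈ range K, u₂ (c (b₁, b₂) k).1 (c (b₁, b₂) k).2)) :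
    GLSpp u₁ u₂ := by
  refine ⟨K + 1, by omega, fun h => (firstThen a c h).1, fun h => (firstThen a c h).2, ?_,
    [], by simp, ha⟩
  rw [isSPEpp_iff]
  rintro (_ | ⟨b, t⟩) -
  · unfold contGame
    simpa only [show firstThen a c [] = a from rfl, List.nil_append, purePay_firstThen, List.length_nil, zero_add,
      Nat.sub_zero, Nat.add_sub_cancel] using hN
  · unfold contGame
    simp only [List.cons_append, purePay_firstThen, List.length_append,
      List.length_singleton]
    exact ⟨fun b' => by simpa [firstThen] using (hc b t.length).1 b',
      fun b' => by simpa [firstThen] using (hc b t.length).2 b'⟩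

theorem exists_nat_forall_le_add_mul {α : Type*} [Finite α] (f : α → ℝ) (x : ℝ) {δ : ℝ}
    (hδ : 0 < δ) : ∃ n : ℕ, ∀ m : ℕ, n ≤ m → ∀ a, f a ≤ x + m * δ := by
  obtain ⟨M, hM⟩ := (Set.finite_range f).bddAbove
  obtain ⟨n, hn⟩ := exists_nat_ge ((M - x) / δ)
  refine ⟨n, fun m hm a => ?_⟩
  have h₁ : f a ≤ M := hM ⟨a, rfl⟩
  have h₂ : (M - x) / δ ≤ m := hn.trans (by exact_mod_cast hm)
  rw [div_le_iff₀ hδ] at h₂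
  linarith

theorem GLSpp_of_nontrivial {u₁ u₂ : A₁ → A₂ → ℝ} (h₁ : (V1pp u₁ u₂).Nontrivial)
    (h₂ : (V2pp u₁ u₂).Nontrivial) {a₁ : A₁} {a₂ : A₂} (ha : (a₁, a₂) ∉ NashPP u₁ u₂) :
    GLSpp u₁ u₂ := by
  obtain ⟨e₁, he₁, hmin₁⟩ := Set.exists_min_image (NashPP u₁ u₂) (fun q => u₁ q.1 q.2)
    (Set.toFinite _) h₁.nonempty.of_image
  obtain ⟨e₂, he₂, hmin₂⟩ := Set.exists_min_image (NashPP u₁ u₂) (fun q => u₂ q.1 q.2)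
    (Set.toFinite _) h₂.nonempty.of_image
  obtain ⟨_, ⟨f₁, hf₁, rfl⟩, hne₁⟩ := h₁.exists_ne (u₁ e₁.1 e₁.2)
  obtain ⟨_, ⟨f₂, hf₂, rfl⟩, hne₂⟩ := h₂.exists_ne (u₂ e₂.1 e₂.2)
  have hlt₁ := lt_of_le_of_ne (hmin₁ f₁ hf₁) hne₁.symm
  have hlt₂ := lt_of_le_of_ne (hmin₂ f₂ hf₂) hne₂.symm
  obtain ⟨n₁, hn₁⟩ := exists_nat_forall_le_add_mul (fun b => u₁ b a₂) (u₁ a₁ a₂)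
    (sub_pos.2 hlt₁)
  obtain ⟨n₂, hn₂⟩ := exists_nat_forall_le_add_mul (fun b => u₂ a₁ b) (u₂ a₁ a₂)
    (sub_pos.2 hlt₂)
  let n := max n₁ n₂
  have hsum : ∀ u : A₁ → A₂ → ℝ, ∑ k ∈ range (n + n),
      u (if k < n then f₁ else f₂).1 (if k < n then f₁ else f₂).2 =
        n * u f₁.1 f₁.2 + n * u f₂.1 f₂.2 := by
    intro u
    rw [sum_range_add, sum_congr rfl fun k hk => by rw [if_pos (mem_range.1 hk)]]
    simp
  refine GLSpp_of_continuation (a₁, a₂) ha (n + n)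
    (fun b k => if b.1 = a₁ then if b.2 = a₂ then if k < n then f₁ else f₂ else e₂ else e₁)
    (fun b k => ?_) ⟨fun b => ?_, fun b => ?_⟩
  · split_ifs <;> assumption
  · by_cases hb : b = a₁
    · rw [hb]
    · have hgain := hn₁ n (le_max_left _ _) b
      have hf := mul_le_mul_of_nonneg_left (hmin₁ f₂ hf₂) (Nat.cast_nonneg (α := ℝ) n)
      simp only [hb, if_true, if_false, hsum, sum_const, card_range, nsmul_eq_mul]
      push_cast
      linarith
  · by_cases hb : b = a₂
    · rw [hb]
    · have hgain := hn₂ n (le_max_right _ _) b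
      have hf := mul_le_mul_of_nonneg_left (hmin₂ f₁ hf₁) (Nat.cast_nonneg (α := ℝ) n)
      simp only [hb, if_true, if_false, hsum, sum_const, card_range, nsmul_eq_mul]
      push_cast
      linarith

theorem GLSpp_of_nontrivial_of_BR2p {u₁ u₂ : A₁ → A₂ → ℝ} (h₁ : (V1pp u₁ u₂).Nontrivial)
    {a₁ : A₁} {a₂ : A₂} (ha : (a₁, a₂) ∉ NashPP u₁ u₂)
    (hbr : BR2p u₂ a₁ a₂) : GLSpp u₁ u₂ := by
  obtain ⟨_, ⟨e, he, rfl⟩, _, ⟨f, hf, rfl⟩, hlt⟩ := h₁.exists_lt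
  obtain ⟨n, hn⟩ := exists_nat_forall_le_add_mul (fun b => u₁ b a₂) (u₁ a₁ a₂) (sub_pos.2 hlt)
  refine GLSpp_of_continuation (a₁, a₂) ha n (fun b _ => if b.1 = a₁ then f else e)
    (fun b k => ?_) ⟨fun b => ?_, fun b => ?_⟩
  · split_ifs <;> assumption
  · by_cases hb : b = a₁
    · rw [hb]
    · have hgain := hn n le_rfl b
      simp only [hb, if_true, if_false, sum_const, card_range, nsmul_eq_mul]
      linarith
  · simpa using hbr b

theorem GLSpp_of_nontrivial_of_BR1p {u₁ u₂ : A₁ → A₂ → ℝ}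
    (h₂ : (V2pp u₁ u₂).Nontrivial) {a₁ : A₁} {a₂ : A₂} (ha : (a₁, a₂) ∉ NashPP u₁ u₂)
    (hbr : BR1p u₁ a₁ a₂) : GLSpp u₁ u₂ := by
  obtain ⟨_, ⟨e, he, rfl⟩, _, ⟨f, hf, rfl⟩, hlt⟩ := h₂.exists_lt
  obtain ⟨n, hn⟩ := exists_nat_forall_le_add_mul (fun b => u₂ a₁ b) (u₂ a₁ a₂) (sub_pos.2 hlt)
  refine GLSpp_of_continuation (a₁, a₂) ha n (fun b _ => if b.2 = a₂ then f else e)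
    (fun b k => ?_) ⟨fun b => ?_, fun b => ?_⟩
  · split_ifs <;> assumption
  · simpa using hbr b
  · by_cases hb : b = a₂
    · rw [hb]
    · have hgain := hn n le_rfl b
      simp only [hb, if_true, if_false, sum_const, card_range, nsmul_eq_mul]
      linarith

end Sufficiency

section TwoPlayer
variable {A₁ A₂ : Type*} [Fintype A₁] [Fintype A₂] [DecidableEq A₁] [DecidableEq A₂]
variable [Nonempty A₁] [Nonempty A₂]

/-- Theorem (2-player, pure strategy): local suboptimality occurs in some SPE of some
finitely repeated game `G(T)` (both players pure) iff the pure-pure condition holds. -/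
theorem localSuboptimality_pure_iff (u₁ u₂ : A₁ → A₂ → ℝ) :
    GLSpp u₁ u₂ ↔ condPP u₁ u₂ := by
  refine ⟨condPP_of_GLSpp, ?_⟩
  rintro (⟨h₁, h₂, _, _, ha⟩ | ⟨h₁, -, _, _, _, hlt, hbr⟩ | ⟨-, h₂, _, _, _, hlt, hbr⟩)
  · exact GLSpp_of_nontrivial h₁ h₂ ha
  · exact GLSpp_of_nontrivial_of_BR2p h₁ (fun hN => (hN.1 _).not_gt hlt) hbr
  · exact GLSpp_of_nontrivial_of_BR1p h₂ (fun hN => (hN.2 _).not_gt hlt) hbr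

end TwoPlayer
end

section
/- For a general 2-player stage game G in which both players may use mixed strategies, there exist some T ≥ 1 and some subgame-perfect equilibrium of the repeated game G(T) in which local suboptimality occurs if and only if at least one of the following holds: (1) |V₁^{m,m}| > 1, |V₂^{m,m}| > 1, and there exist mixed strategies σ̂₁ ∈ ΔA₁, σ̂₂ ∈ ΔA₂ with (σ̂₁, σ̂₂) ∉ Nash^{m,m}(G); OR (2) |V₁^{m,m}| > 1, |V₂^{m,m}| = 1, and there exist σ̂₁ ∈ ΔA₁, σ̂₂ ∈ ΔA₂, a₁′ ∈ A₁ with u₁(σ̂₁, σ̂₂) < u₁(a₁′, σ̂₂) and σ̂₂ a best response to σ̂₁; OR (3) the condition of (2) with the roles of players 1 and 2 exchanged. -/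
open Finset

/-- A linear functional on the probability vectors satisfying finitely many homogeneous linear
inequalities can be decreased to a vertex: a point whose support is no larger than its set of
tight inequalities, provided one of the inequalities is trivial. -/
theorem exists_vertex_le {A B : Type*} [Fintype A] [Fintype B] [DecidableEq A] [DecidableEq B]
    (v : A → B → ℝ) (f : A → ℝ) (b₀ : B) (hv : ∀ a, v a b₀ = 0) {σ : A → ℝ}
    (hσ : σ ∈ stdSimplex ℝ A) (hσv : ∀ b, ∑ a, σ a * v a b ≤ 0) :
    ∃ p ∈ stdSimplex ℝ A, (∀ b, ∑ a, p a * v a b ≤ 0) ∧ ∑ a, p a * f a ≤ ∑ a, σ a * f a ∧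
      Fintype.card {a // p a ≠ 0} ≤ Fintype.card {b // ∑ a, p a * v a b = 0} := by
  classical
  let P : Set (A → ℝ) := {p | p ∈ stdSimplex ℝ A ∧ ∀ b, ∑ a, p a * v a b ≤ 0}
  have hPc : IsCompact P := by
    have hcl : IsClosed {p : A → ℝ | ∀ b, ∑ a, p a * v a b ≤ 0} := by
      simp only [Set.ofPred_forall]
      exact isClosed_iInter fun b => isClosed_le (by fun_prop) continuous_const
    exact (isCompact_stdSimplex ℝ A).inter_right hcl
  have hfc : Continuous fun p : A → ℝ => ∑ a, p a * f a := by fun_prop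
  obtain ⟨p₀, hp₀, hmin⟩ := hPc.exists_isMinOn ⟨σ, hσ, hσv⟩ hfc.continuousOn
  rw [isMinOn_iff] at hmin
  let F : Set (A → ℝ) := P ∩ {p | ∑ a, p a * f a ≤ ∑ a, p₀ a * f a}
  have hFc : IsCompact F := hPc.inter_right (isClosed_le hfc continuous_const)
  obtain ⟨p, hpF, hpe⟩ := hFc.extremePoints_nonempty ⟨p₀, hp₀, by simp⟩
  refine ⟨p, hpF.1.1, hpF.1.2, hpF.2.trans (hmin σ ⟨hσ, hσv⟩), ?_⟩
  by_contra! hcard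
  let Λ : ({a // p a ≠ 0} → ℝ) →ₗ[ℝ] ({b // ∑ a, p a * v a b = 0} → ℝ) :=
    LinearMap.pi fun b => ∑ a, (if b.1 = b₀ then 1 else v a.1 b.1) • LinearMap.proj a
  have hker : LinearMap.ker Λ ≠ ⊥ :=
    LinearMap.ker_ne_bot_of_finrank_lt (by simpa using hcard)
  obtain ⟨t, ht, ht0⟩ := (Submodule.ne_bot_iff _).1 hker
  have hΛ : ∀ b : {b // ∑ a, p a * v a b = 0},
      ∑ a, (if b.1 = b₀ then 1 else v a.1 b.1) * t a = 0 := by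
    intro b
    have := congrFun (LinearMap.mem_ker.1 ht) b
    by_cases hb : b.1 = b₀ <;> simpa [Λ, hb] using this
  let τ : A → ℝ := fun a => if h : p a ≠ 0 then t ⟨a, h⟩ else 0
  have hτ : ∀ g : A → ℝ, ∑ a, τ a * g a = ∑ a : {a // p a ≠ 0}, t a * g a := by
    intro g
    rw [← Finset.sum_filter_add_sum_filter_not univ fun a => p a ≠ 0,
      Finset.sum_subtype (univ.filter fun a => p a ≠ 0) (p := fun a => p a ≠ 0) (by simp),
      Finset.sum_eq_zero (s := univ.filter fun a => ¬ p a ≠ 0), add_zero]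
    · exact Finset.sum_congr rfl fun a _ => by simp [τ, a.2]
    · intro a ha
      simp only [Finset.mem_filter, Finset.mem_univ, true_and] at ha
      simp only [τ, dif_neg ha, zero_mul]
  have hτ1 : ∑ a, τ a = 0 := by
    have h1 := hτ fun _ => 1
    have h2 := hΛ ⟨b₀, by simp [hv]⟩
    simp only [mul_one, if_true, one_mul] at h1 h2
    rw [h1, h2]
  have hτv : ∀ b, ∑ a, p a * v a b = 0 → ∑ a, τ a * v a b = 0 := by
    intro b hb
    by_cases hbb : b = b₀
    · simp [hbb, hv]
    · have h2 := hΛ ⟨b, hb⟩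
      simp only [hbb, if_false] at h2
      exact (hτ _).trans ((Finset.sum_congr rfl fun a _ => mul_comm _ _).trans h2)
  have hsum : ∀ (s : ℝ) (g : A → ℝ), ∑ a, (p + s • τ) a * g a
      = ∑ a, p a * g a + s * ∑ a, τ a * g a := by
    intro s g
    simp only [Pi.add_apply, Pi.smul_apply, smul_eq_mul, add_mul, Finset.sum_add_distrib,
      Finset.mul_sum, mul_assoc]
  have hev : ∀ᶠ s in nhds (0 : ℝ), p + s • τ ∈ P := by
    have h1 : ∀ a, ∀ᶠ s in nhds (0 : ℝ), 0 ≤ (p + s • τ) a := by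
      intro a
      by_cases ha : p a = 0
      · simp [τ, ha]
      · have hpa : 0 < p a := lt_of_le_of_ne (hpF.1.1.1 a) (Ne.symm ha)
        have hc : ContinuousAt (fun s : ℝ => (p + s • τ) a) 0 := by
          simp only [Pi.add_apply, Pi.smul_apply, smul_eq_mul]; fun_prop
        exact (hc.eventually (lt_mem_nhds (by simpa using hpa))).mono fun s hs => hs.le
    have h2 : ∀ b, ∀ᶠ s in nhds (0 : ℝ), ∑ a, (p + s • τ) a * v a b ≤ 0 := by
      intro b
      simp only [hsum]
      by_cases hb : ∑ a, p a * v a b = 0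
      · simp [hb, hτv b hb]
      · have hlt := lt_of_le_of_ne (hpF.1.2 b) hb
        have hc : ContinuousAt (fun s : ℝ => ∑ a, p a * v a b + s * ∑ a, τ a * v a b) 0 := by
          fun_prop
        exact (hc.eventually (gt_mem_nhds (by simpa using hlt))).mono fun s hs => hs.le
    filter_upwards [Filter.eventually_all.2 h1, Filter.eventually_all.2 h2] with s hs1 hs2
    refine ⟨⟨hs1, ?_⟩, hs2⟩
    have := hsum s fun _ => 1
    simp only [mul_one] at this
    rw [this, hτ1, hpF.1.1.2]; simp
  obtain ⟨ε, hε, hb⟩ := Metric.eventually_nhds_iff.1 hev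
  have hm1 : p + (ε / 2) • τ ∈ P := hb (by simp [abs_of_pos hε]; linarith)
  have hm2 : p + (-(ε / 2)) • τ ∈ P := hb (by simp [abs_of_pos hε]; linarith)
  have hpf : ∑ a, p a * f a ≤ ∑ a, p₀ a * f a := hpF.2
  have e1 := hmin _ hm1
  have e2 := hmin _ hm2
  simp only [hsum] at e1 e2
  have k1 : p + (ε / 2) • τ ∈ F := ⟨hm1, by simp only [Set.mem_ofPred_eq, hsum]; linarith⟩
  have k2 : p + (-(ε / 2)) • τ ∈ F := ⟨hm2, by simp only [Set.mem_ofPred_eq, hsum]; linarith⟩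
  have hseg : p ∈ openSegment ℝ (p + (ε / 2) • τ) (p + (-(ε / 2)) • τ) :=
    ⟨1 / 2, 1 / 2, by norm_num, by norm_num, by norm_num, by
      ext a; simp only [Pi.add_apply, Pi.smul_apply, smul_eq_mul]; ring⟩
  have heq := hpe k1 k2 hseg
  apply ht0
  ext a
  have h3 := congrFun heq a.1
  simp only [Pi.add_apply, Pi.smul_apply, smul_eq_mul, add_eq_left, mul_eq_zero] at h3
  have h4 : τ a.1 = t a := by simp [τ, a.2]
  rcases h3 with h3 | h3
  · linarith
  · simpa [h4] using h3

/-- A real square system with nonpositive off-diagonal part and strict row dominance has a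
solution for the all-ones right-hand side, with explicit bounds. -/
theorem exists_dominant_solution {ι : Type*} [Fintype ι] [Nonempty ι] [DecidableEq ι]
    (W : ι → ι → ℝ) (hW : ∀ i j, 0 ≤ W i j) (D : ι → ℝ) (hD : ∀ i, ∑ j, W i j + 1 ≤ D i) :
    ∃ q : ι → ℝ, (∀ i, 0 < q i ∧ q i ≤ 1) ∧ ∀ i, D i * q i = 1 + ∑ j, W i j * q j := by
  have hpos : ∀ (c : ℝ) (x : ι → ℝ), 0 ≤ c → (∀ i, D i * x i = c + ∑ j, W i j * x j) →
      ∀ i, 0 ≤ x i := by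
    intro c x hc hx
    obtain ⟨k, hk⟩ := Finite.exists_min x
    have h1 : (∑ j, W k j) * x k ≤ ∑ j, W k j * x j := by
      rw [Finset.sum_mul]
      exact Finset.sum_le_sum fun j _ => mul_le_mul_of_nonneg_left (hk j) (hW k j)
    have h2 := hx k
    have h3 : 0 ≤ x k := by
      by_contra! hneg
      nlinarith [hD k]
    exact fun i => h3.trans (hk i)
  let Φ : (ι → ℝ) →ₗ[ℝ] (ι → ℝ) :=
    LinearMap.pi fun i => D i • LinearMap.proj i - ∑ j, W i j • LinearMap.proj j
  have hΦ : ∀ x i, Φ x i = D i * x i - ∑ j, W i j * x j := by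
    intro x i; simp [Φ]
  have hinj : Function.Injective Φ := by
    rw [← LinearMap.ker_eq_bot, LinearMap.ker_eq_bot']
    intro x hx
    have hx' : ∀ i, D i * x i - ∑ j, W i j * x j = 0 := fun i => by rw [← hΦ, hx]; rfl
    have h1 := hpos 0 x le_rfl fun i => by linarith [hx' i]
    have h2 := hpos 0 (-x) le_rfl fun i => by
      simp only [Pi.neg_apply, mul_neg, Finset.sum_neg_distrib]; linarith [hx' i]
    ext i
    have := h2 i
    simp only [Pi.neg_apply] at this
    simp only [Pi.zero_apply]
    linarith [h1 i]
  obtain ⟨q, hq⟩ := LinearMap.injective_iff_surjective.1 hinj fun _ => 1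
  have hq' : ∀ i, D i * q i = 1 + ∑ j, W i j * q j := fun i => by
    have := congrFun hq i
    rw [hΦ] at this
    linarith
  have hq0 := hpos 1 q zero_le_one hq'
  refine ⟨q, fun i => ⟨?_, ?_⟩, hq'⟩
  · refine lt_of_le_of_ne (hq0 i) fun h => ?_
    have := hq' i
    rw [← h, mul_zero] at this
    linarith [Finset.sum_nonneg fun j (_ : j ∈ univ) => mul_nonneg (hW i j) (hq0 j)]
  · obtain ⟨k, hk⟩ := Finite.exists_max q
    have h1 : ∑ j, W k j * q j ≤ (∑ j, W k j) * q k := by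
      rw [Finset.sum_mul]
      exact Finset.sum_le_sum fun j _ => mul_le_mul_of_nonneg_left (hk j) (hW k j)
    have h2 := hq' k
    have h3 : q k ≤ 1 := by nlinarith [hD k, hq0 k]
    exact (hk i).trans h3

/-- Adding suitable integral multiples of `δ` to the diagonal of a square matrix makes it possible
to equalize its rows by a positive probability vector that is as concentrated at `i₀` as the sign
of `∑ j, q j * d j` requires. -/
theorem exists_equalizing_weights {ι : Type*} [Fintype ι] [DecidableEq ι] (U : ι → ι → ℝ)
    {δ : ℝ} (hδ : 0 < δ) (d : ι → ℝ) (i₀ : ι) (hd : 0 < d i₀) :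
    ∃ (w : ι → ℕ) (q : ι → ℝ) (c : ℝ), (∀ i, 0 ≤ q i) ∧ ∑ i, q i = 1 ∧
      (∀ i, δ * w i * q i + ∑ j, q j * U i j = c) ∧ 0 < ∑ j, q j * d j := by
  have : Nonempty ι := ⟨i₀⟩
  obtain ⟨m, hm⟩ : ∃ m, ∀ i j, U i j ≤ m := by
    obtain ⟨k, hk⟩ := Finite.exists_max fun x : ι × ι => U x.1 x.2
    exact ⟨_, fun i j => hk (i, j)⟩
  obtain ⟨k, hk⟩ := Finite.exists_max fun i => ∑ j, (m - U i j)
  obtain ⟨L, hL⟩ := exists_nat_gt ((∑ j, (m - U k j) + 1) / δ)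
  rw [div_lt_iff₀ hδ] at hL
  set B := ∑ j, (m - U k j)
  have hB : 0 ≤ B := Finset.sum_nonneg fun j _ => sub_nonneg.2 (hm k j)
  set Dm := ∑ j, |d j|
  have hDm : 0 ≤ Dm := Finset.sum_nonneg fun j _ => abs_nonneg _
  have hLδ : 0 < L * δ := by linarith
  obtain ⟨R, hR⟩ := exists_nat_gt (Dm * (L * δ) / d i₀ + 1)
  have hR1 : (1 : ℝ) ≤ R := by
    have : 0 ≤ Dm * (L * δ) / d i₀ := by positivity
    linarith
  have hR2 : Dm * (L * δ) < d i₀ * R := by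
    have : Dm * (L * δ) / d i₀ < R := by linarith
    rw [div_lt_iff₀ hd] at this
    linarith
  let w : ι → ℕ := fun i => if i = i₀ then L else L * R
  have hw : ∀ i, L * δ ≤ δ * w i := by
    intro i
    by_cases hi : i = i₀
    · simp [w, hi, mul_comm]
    · simp only [w, hi, if_false, Nat.cast_mul]
      nlinarith
  obtain ⟨q, hq, hqe⟩ := exists_dominant_solution (fun i j => m - U i j)
    (fun i j => sub_nonneg.2 (hm i j)) (fun i => δ * w i)
    (fun i => by linarith [hk i, hw i])
  have hQ : 0 < ∑ j, q j := Finset.sum_pos (fun j _ => (hq j).1) univ_nonempty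
  have hsmall : ∀ i, ∑ j, (m - U i j) * q j ≤ B := fun i =>
    (Finset.sum_le_sum fun j _ => mul_le_of_le_one_right (sub_nonneg.2 (hm i j)) (hq j).2).trans
      (hk i)
  have hsplit : ∀ i, ∑ j, (m - U i j) * q j = m * ∑ j, q j - ∑ j, q j * U i j := by
    intro i
    rw [Finset.mul_sum, ← Finset.sum_sub_distrib]
    exact Finset.sum_congr rfl fun j _ => by ring
  have hq0 : 1 ≤ (L * δ) * q i₀ := by
    have h1 := hqe i₀
    have h2 : 0 ≤ ∑ j, (m - U i₀ j) * q j :=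
      Finset.sum_nonneg fun j _ => mul_nonneg (sub_nonneg.2 (hm i₀ j)) (hq j).1.le
    simp only [w, if_true] at h1
    linarith
  have hqj : ∀ j, j ≠ i₀ → R * q j ≤ 1 := by
    intro j hj
    have h1 := hqe j
    simp only [w, hj, if_false, Nat.cast_mul] at h1
    have h2 := hsmall j
    have h3 : (L * δ) * (R * q j) ≤ (L * δ) * 1 := by linarith
    exact le_of_mul_le_mul_left h3 hLδ
  have hdpos : 0 < ∑ j, q j * d j := by
    have hRpos : (0 : ℝ) < R := by linarith
    have h1 : R * ∑ j ∈ univ.erase i₀, q j * d j ≥ -Dm := by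
      have h2 : ∑ j ∈ univ.erase i₀, |d j| ≤ Dm :=
        Finset.sum_le_sum_of_subset_of_nonneg (Finset.erase_subset _ _) fun j _ _ => abs_nonneg _
      have h3 : ∑ j ∈ univ.erase i₀, (-|d j|) ≤ ∑ j ∈ univ.erase i₀, R * (q j * d j) := by
        refine Finset.sum_le_sum fun j hj => ?_
        have h4 := hqj j (Finset.ne_of_mem_erase hj)
        have h5 : 0 ≤ R * q j := mul_nonneg hRpos.le (hq j).1.le
        have h6 := neg_abs_le (d j)
        have h7 := abs_nonneg (d j)
        nlinarith
      rw [Finset.sum_neg_distrib] at h3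
      rw [Finset.mul_sum]
      linarith
    rw [← Finset.add_sum_erase _ _ (Finset.mem_univ i₀)]
    have h8 : Dm < R * (q i₀ * d i₀) := by
      have : Dm * (L * δ) < (R * (q i₀ * d i₀)) * (L * δ) := by
        have : d i₀ * R * 1 ≤ d i₀ * R * (L * δ * q i₀) :=
          mul_le_mul_of_nonneg_left hq0 (by positivity)
        nlinarith
      exact lt_of_mul_lt_mul_right this hLδ.le
    have h9 : 0 < R * (q i₀ * d i₀ + ∑ j ∈ univ.erase i₀, q j * d j) := by
      rw [mul_add]; linarith
    exact pos_of_mul_pos_right h9 hRpos.le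
  refine ⟨w, fun i => q i / ∑ j, q j, m + 1 / ∑ j, q j, fun i => (div_pos (hq i).1 hQ).le, ?_, ?_,
    ?_⟩
  · rw [← Finset.sum_div, div_self hQ.ne']
  · intro i
    have h1 := hqe i
    rw [hsplit] at h1
    have h2 : ∑ j, q j / (∑ j, q j) * U i j = (∑ j, q j * U i j) / ∑ j, q j := by
      rw [Finset.sum_div]
      exact Finset.sum_congr rfl fun j _ => by ring
    rw [h2]
    field_simp
    linarith
  · have h2 : ∑ j, q j / (∑ j, q j) * d j = (∑ j, q j * d j) / ∑ j, q j := by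
      rw [Finset.sum_div]
      exact Finset.sum_congr rfl fun j _ => by ring
    rw [h2]
    exact div_pos hdpos hQ

namespace Mix

variable {A : Type*} [Fintype A]

theorem sum_mul_le (σ : Mix A) {f : A → ℝ} {K : ℝ} (hf : ∀ a, f a ≤ K) :
    ∑ a, σ.p a * f a ≤ K :=
  (Finset.sum_le_sum fun a _ => mul_le_mul_of_nonneg_left (hf a) (σ.nonneg a)).trans_eq <| by
    rw [← Finset.sum_mul, σ.sum_one, one_mul]

theorem sum_mul_eq (σ : Mix A) {f : A → ℝ} {K : ℝ} (hf : ∀ a, 0 < σ.p a → f a = K) :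
    ∑ a, σ.p a * f a = K := by
  have h : ∀ a ∈ univ, σ.p a * f a = σ.p a * K := fun a _ => by
    rcases (σ.nonneg a).eq_or_lt with h | h
    · rw [← h, zero_mul, zero_mul]
    · rw [hf a h]
  rw [Finset.sum_congr rfl h, ← Finset.sum_mul, σ.sum_one, one_mul]

theorem exists_pos_of_sum_mul_lt (σ : Mix A) {f g : A → ℝ}
    (h : ∑ a, σ.p a * f a < ∑ a, σ.p a * g a) : ∃ a, 0 < σ.p a ∧ f a < g a := by
  obtain ⟨a, -, ha⟩ := Finset.exists_lt_of_sum_lt h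
  have hpos : 0 < σ.p a := (σ.nonneg a).lt_of_ne fun h0 => by simp [← h0] at ha
  exact ⟨a, hpos, lt_of_mul_lt_mul_left ha hpos.le⟩

theorem pure_sum_mul [DecidableEq A] (a : A) (f : A → ℝ) : ∑ b, (pure a).p b * f b = f a := by
  simp [pure]

end Mix

section StageGame

variable {A₁ A₂ : Type*} [Fintype A₁] [Fintype A₂]

theorem expPay_eq_sum_left (u : A₁ → A₂ → ℝ) (σ₁ : Mix A₁) (σ₂ : Mix A₂) :
    expPay u σ₁ σ₂ = ∑ a, σ₁.p a * ∑ b, σ₂.p b * u a b := by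
  simp only [expPay, Finset.mul_sum, mul_assoc]

theorem expPay_eq_sum_right (u : A₁ → A₂ → ℝ) (σ₁ : Mix A₁) (σ₂ : Mix A₂) :
    expPay u σ₁ σ₂ = ∑ b, σ₂.p b * ∑ a, σ₁.p a * u a b := by
  simp only [expPay, Finset.mul_sum]
  rw [Finset.sum_comm]
  exact Finset.sum_congr rfl fun b _ => Finset.sum_congr rfl fun a _ => by ring

theorem expPay_flip (u : A₁ → A₂ → ℝ) (σ₁ : Mix A₁) (σ₂ : Mix A₂) :
    expPay (flip u) σ₂ σ₁ = expPay u σ₁ σ₂ := by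
  rw [expPay_eq_sum_left, expPay_eq_sum_right]; rfl

theorem expPay_add_const (u : A₁ → A₂ → ℝ) (c : ℝ) (σ₁ : Mix A₁) (σ₂ : Mix A₂) :
    expPay (fun a b => u a b + c) σ₁ σ₂ = expPay u σ₁ σ₂ + c := by
  simp only [expPay_eq_sum_left, mul_add, Finset.sum_add_distrib, ← Finset.sum_mul, σ₂.sum_one,
    σ₁.sum_one, one_mul]

theorem expPay_mono {u w : A₁ → A₂ → ℝ} (h : ∀ a b, u a b ≤ w a b) (σ₁ : Mix A₁) (σ₂ : Mix A₂) :
    expPay u σ₁ σ₂ ≤ expPay w σ₁ σ₂ :=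
  Finset.sum_le_sum fun a _ => Finset.sum_le_sum fun b _ =>
    mul_le_mul_of_nonneg_left (h a b) (mul_nonneg (σ₁.nonneg a) (σ₂.nonneg b))

theorem BR1m_flip {u : A₁ → A₂ → ℝ} {σ₁ : Mix A₁} {σ₂ : Mix A₂} :
    BR1m (flip u) σ₂ σ₁ ↔ BR2m u σ₁ σ₂ := by
  simp only [BR1m, BR2m, expPay_flip]

theorem BR2m_flip {u : A₁ → A₂ → ℝ} {σ₁ : Mix A₁} {σ₂ : Mix A₂} :
    BR2m (flip u) σ₂ σ₁ ↔ BR1m u σ₁ σ₂ := by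
  simp only [BR1m, BR2m, expPay_flip]

theorem mem_NashMM_flip {u₁ u₂ : A₁ → A₂ → ℝ} {σ₁ : Mix A₁} {σ₂ : Mix A₂} :
    (σ₂, σ₁) ∈ NashMM (flip u₂) (flip u₁) ↔ (σ₁, σ₂) ∈ NashMM u₁ u₂ := by
  change BR1m (flip u₂) σ₂ σ₁ ∧ BR2m (flip u₁) σ₂ σ₁ ↔ BR1m u₁ σ₁ σ₂ ∧ BR2m u₂ σ₁ σ₂
  rw [BR1m_flip, BR2m_flip, and_comm]

theorem V1mm_flip (u₁ u₂ : A₁ → A₂ → ℝ) : V1mm (flip u₂) (flip u₁) = V2mm u₁ u₂ := by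
  ext x
  constructor
  · rintro ⟨q, hq, rfl⟩
    exact ⟨(q.2, q.1), mem_NashMM_flip.1 hq, (expPay_flip _ _ _).symm⟩
  · rintro ⟨q, hq, rfl⟩
    exact ⟨(q.2, q.1), mem_NashMM_flip.2 hq, expPay_flip _ _ _⟩

theorem V2mm_flip (u₁ u₂ : A₁ → A₂ → ℝ) : V2mm (flip u₂) (flip u₁) = V1mm u₁ u₂ :=
  (V1mm_flip (flip u₂) (flip u₁)).symm

theorem expPay_pure_left [DecidableEq A₁] (u : A₁ → A₂ → ℝ) (a : A₁) (σ₂ : Mix A₂) :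
    expPay u (Mix.pure a) σ₂ = ∑ b, σ₂.p b * u a b := by
  rw [expPay_eq_sum_left, Mix.pure_sum_mul]

theorem expPay_pure_right [DecidableEq A₂] (u : A₁ → A₂ → ℝ) (σ₁ : Mix A₁) (b : A₂) :
    expPay u σ₁ (Mix.pure b) = ∑ a, σ₁.p a * u a b := by
  rw [expPay_eq_sum_right, Mix.pure_sum_mul]

theorem BR1m_of_forall_pure [DecidableEq A₁] {u : A₁ → A₂ → ℝ} {σ₁ : Mix A₁} {σ₂ : Mix A₂}
    (h : ∀ a, expPay u (Mix.pure a) σ₂ ≤ expPay u σ₁ σ₂) : BR1m u σ₁ σ₂ := fun τ => by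
  rw [expPay_eq_sum_left]
  exact τ.sum_mul_le fun a => by simpa only [expPay_pure_left] using h a

theorem BR2m_of_forall_pure [DecidableEq A₂] {u : A₁ → A₂ → ℝ} {σ₁ : Mix A₁} {σ₂ : Mix A₂}
    (h : ∀ b, expPay u σ₁ (Mix.pure b) ≤ expPay u σ₁ σ₂) : BR2m u σ₁ σ₂ := fun τ => by
  rw [expPay_eq_sum_right]
  exact τ.sum_mul_le fun b => by simpa only [expPay_pure_right] using h b

variable [DecidableEq A₁] [DecidableEq A₂]

theorem expPay_pure_pure (u : A₁ → A₂ → ℝ) (a : A₁) (b : A₂) :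
    expPay u (Mix.pure a) (Mix.pure b) = u a b := by
  rw [expPay_pure_left, Mix.pure_sum_mul]

theorem pure_mem_NashMM_iff {u₁ u₂ : A₁ → A₂ → ℝ} {a : A₁} {b : A₂} :
    (Mix.pure a, Mix.pure b) ∈ NashMM u₁ u₂ ↔ BR1p u₁ a b ∧ BR2p u₂ a b := by
  refine ⟨fun h => ⟨fun a' => ?_, fun b' => ?_⟩, fun h => ⟨?_, ?_⟩⟩
  · simpa only [expPay_pure_pure] using h.1 (Mix.pure a')
  · simpa only [expPay_pure_pure] using h.2 (Mix.pure b')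
  · exact BR1m_of_forall_pure fun a' => by simpa only [expPay_pure_pure] using h.1 a'
  · exact BR2m_of_forall_pure fun b' => by simpa only [expPay_pure_pure] using h.2 b'

/-- If every pure profile is an equilibrium then so is every mixed one. -/
theorem exists_pure_notMem_NashMM {u₁ u₂ : A₁ → A₂ → ℝ} {σ₁ : Mix A₁} {σ₂ : Mix A₂}
    (h : (σ₁, σ₂) ∉ NashMM u₁ u₂) : ∃ a b, (Mix.pure a, Mix.pure b) ∉ NashMM u₁ u₂ := by
  by_contra! hall
  simp only [pure_mem_NashMM_iff] at hall
  refine h ⟨fun τ => ?_, fun τ => ?_⟩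
  · change expPay u₁ τ σ₂ ≤ expPay u₁ σ₁ σ₂
    rw [expPay_eq_sum_right, expPay_eq_sum_right]
    refine Finset.sum_le_sum fun b _ => mul_le_mul_of_nonneg_left ?_ (σ₂.nonneg b)
    refine τ.sum_mul_le fun a => le_of_eq ?_
    exact (σ₁.sum_mul_eq fun a' _ => le_antisymm ((hall a b).1 a') ((hall a' b).1 a)).symm
  · change expPay u₂ σ₁ τ ≤ expPay u₂ σ₁ σ₂
    rw [expPay_eq_sum_left, expPay_eq_sum_left]
    refine Finset.sum_le_sum fun a _ => mul_le_mul_of_nonneg_left ?_ (σ₁.nonneg a)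
    refine τ.sum_mul_le fun b => le_of_eq ?_
    exact (σ₂.sum_mul_eq fun b' _ => le_antisymm ((hall a b).2 b') ((hall a b').2 b)).symm

/-- A failure of player 1 to best respond to a best response of player 2 can be witnessed against a
pure action. -/
theorem exists_pure_of_BR2m {u₁ u₂ : A₁ → A₂ → ℝ} {σ₁ : Mix A₁} {σ₂ : Mix A₂} {a' : A₁}
    (hlt : expPay u₁ σ₁ σ₂ < expPay u₁ (Mix.pure a') σ₂) (hbr : BR2m u₂ σ₁ σ₂) :
    ∃ b₀, (∑ a, σ₁.p a * u₁ a b₀ < u₁ a' b₀) ∧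
      ∀ b, ∑ a, σ₁.p a * u₂ a b ≤ ∑ a, σ₁.p a * u₂ a b₀ := by
  rw [expPay_eq_sum_right, expPay_pure_left] at hlt
  obtain ⟨b₀, hb₀, hlt₀⟩ := σ₂.exists_pos_of_sum_mul_lt hlt
  refine ⟨b₀, hlt₀, fun b => ?_⟩
  have hle : ∀ b, ∑ a, σ₁.p a * u₂ a b ≤ expPay u₂ σ₁ σ₂ := fun b => by
    simpa only [expPay_pure_right] using hbr (Mix.pure b)
  refine (hle b).trans ?_
  by_contra! hcon
  have h2 : ∑ b, σ₂.p b * ∑ a, σ₁.p a * u₂ a b < ∑ b, σ₂.p b * expPay u₂ σ₁ σ₂ :=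
    Finset.sum_lt_sum (fun b _ => mul_le_mul_of_nonneg_left (hle b) (σ₂.nonneg b))
      ⟨b₀, mem_univ _, mul_lt_mul_of_pos_left hcon hb₀⟩
  rw [← expPay_eq_sum_right, ← Finset.sum_mul, σ₂.sum_one, one_mul] at h2
  exact lt_irrefl _ h2

end StageGame

section RepeatedGame

variable {A₁ A₂ : Type*} [Fintype A₁] [Fintype A₂]

theorem totPay_succ (u : A₁ → A₂ → ℝ) (μ₁ : Hist A₁ A₂ → Mix A₁) (μ₂ : Hist A₁ A₂ → Mix A₂)
    (n : ℕ) (h : Hist A₁ A₂) :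
    totPay u μ₁ μ₂ (n + 1) h
      = expPay (fun a b => u a b + totPay u μ₁ μ₂ n (h ++ [(a, b)])) (μ₁ h) (μ₂ h) :=
  rfl

theorem totPay_le {u : A₁ → A₂ → ℝ} {μ₁ : Hist A₁ A₂ → Mix A₁} {μ₂ : Hist A₁ A₂ → Mix A₂} :
    ∀ (n : ℕ) (h : Hist A₁ A₂) (v : ℕ → ℝ),
      (∀ h' : Hist A₁ A₂, h'.length < n →
        expPay u (μ₁ (h ++ h')) (μ₂ (h ++ h')) ≤ v h'.length) →
      totPay u μ₁ μ₂ n h ≤ ∑ t ∈ range n, v t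
  | 0, h, v, _ => by simp [totPay]
  | n + 1, h, v, hv => by
    rw [totPay_succ, Finset.sum_range_succ', add_comm]
    have ih : ∀ a b, totPay u μ₁ μ₂ n (h ++ [(a, b)]) ≤ ∑ t ∈ range n, v (t + 1) := fun a b =>
      totPay_le n _ (fun t => v (t + 1)) fun h' hh' => by
        simpa using hv ((a, b) :: h') (by simpa using hh')
    refine (expPay_mono (fun a b => add_le_add le_rfl (ih a b)) _ _).trans ?_
    rw [expPay_add_const]
    gcongr
    simpa using hv [] (by simp)

theorem le_totPay {u : A₁ → A₂ → ℝ} {μ₁ : Hist A₁ A₂ → Mix A₁} {μ₂ : Hist A₁ A₂ → Mix A₂} :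
    ∀ (n : ℕ) (h : Hist A₁ A₂) (v : ℕ → ℝ),
      (∀ h' : Hist A₁ A₂, h'.length < n →
        v h'.length ≤ expPay u (μ₁ (h ++ h')) (μ₂ (h ++ h'))) →
      ∑ t ∈ range n, v t ≤ totPay u μ₁ μ₂ n h
  | 0, h, v, _ => by simp [totPay]
  | n + 1, h, v, hv => by
    rw [totPay_succ, Finset.sum_range_succ', add_comm]
    have ih : ∀ a b, ∑ t ∈ range n, v (t + 1) ≤ totPay u μ₁ μ₂ n (h ++ [(a, b)]) := fun a b =>
      le_totPay n _ (fun t => v (t + 1)) fun h' hh' => by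
        simpa using hv ((a, b) :: h') (by simpa using hh')
    refine le_trans ?_ (expPay_mono (fun a b => add_le_add le_rfl (ih a b)) _ _)
    rw [expPay_add_const]
    gcongr
    simpa using hv [] (by simp)

theorem totPay_eq {u : A₁ → A₂ → ℝ} {μ₁ : Hist A₁ A₂ → Mix A₁} {μ₂ : Hist A₁ A₂ → Mix A₂}
    (n : ℕ) (h : Hist A₁ A₂) (v : ℕ → ℝ)
    (hv : ∀ h' : Hist A₁ A₂, h'.length < n →
      expPay u (μ₁ (h ++ h')) (μ₂ (h ++ h')) = v h'.length) :
    totPay u μ₁ μ₂ n h = ∑ t ∈ range n, v t :=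
  le_antisymm (totPay_le n h v fun h' hh' => (hv h' hh').le)
    (le_totPay n h v fun h' hh' => (hv h' hh').ge)

/-- Following a stage profile by history-independent play of stage equilibria gives a
subgame-perfect equilibrium as soon as the stage profile is an equilibrium of the stage game
augmented by the continuation payoffs. -/
theorem GLSmm_of_continuation {u₁ u₂ : A₁ → A₂ → ℝ} {σ₁ : Mix A₁} {σ₂ : Mix A₂} (N : ℕ)
    (e : A₁ → A₂ → ℕ → Mix A₁ × Mix A₂) (he : ∀ a b t, e a b t ∈ NashMM u₁ u₂)
    (h₁ : BR1m (fun a b => u₁ a b + ∑ t ∈ range N, expPay u₁ (e a b t).1 (e a b t).2) σ₁ σ₂)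
    (h₂ : BR2m (fun a b => u₂ a b + ∑ t ∈ range N, expPay u₂ (e a b t).1 (e a b t).2) σ₁ σ₂)
    (hσ : (σ₁, σ₂) ∉ NashMM u₁ u₂) : GLSmm u₁ u₂ := by
  let μ₁ : Hist A₁ A₂ → Mix A₁ := fun h => h.casesOn σ₁ fun q l => (e q.1 q.2 l.length).1
  let μ₂ : Hist A₁ A₂ → Mix A₂ := fun h => h.casesOn σ₂ fun q l => (e q.1 q.2 l.length).2
  refine ⟨N + 1, by omega, μ₁, μ₂, ?_, [], by simp, hσ⟩
  rintro (_ | ⟨q, l⟩) hl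
  · refine ⟨fun μ₁' => ?_, fun μ₂' => ?_⟩
    · change totPay u₁ μ₁' μ₂ (N + 1) [] ≤ totPay u₁ μ₁ μ₂ (N + 1) []
      have hon : ∀ a b, totPay u₁ μ₁ μ₂ N ([] ++ [(a, b)])
          = ∑ t ∈ range N, expPay u₁ (e a b t).1 (e a b t).2 :=
        fun a b => totPay_eq N _ _ fun h' _ => rfl
      have hoff : ∀ a b, totPay u₁ μ₁' μ₂ N ([] ++ [(a, b)])
          ≤ ∑ t ∈ range N, expPay u₁ (e a b t).1 (e a b t).2 :=
        fun a b => totPay_le N _ _ fun h' _ => (he a b h'.length).1 _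
      rw [totPay_succ, totPay_succ]
      simp only [hon]
      exact (expPay_mono (fun a b => add_le_add le_rfl (hoff a b)) _ _).trans (h₁ (μ₁' []))
    · change totPay u₂ μ₁ μ₂' (N + 1) [] ≤ totPay u₂ μ₁ μ₂ (N + 1) []
      have hon : ∀ a b, totPay u₂ μ₁ μ₂ N ([] ++ [(a, b)])
          = ∑ t ∈ range N, expPay u₂ (e a b t).1 (e a b t).2 :=
        fun a b => totPay_eq N _ _ fun h' _ => rfl
      have hoff : ∀ a b, totPay u₂ μ₁ μ₂' N ([] ++ [(a, b)])
          ≤ ∑ t ∈ range N, expPay u₂ (e a b t).1 (e a b t).2 :=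
        fun a b => totPay_le N _ _ fun h' _ => (he a b h'.length).2 _
      rw [totPay_succ, totPay_succ]
      simp only [hon]
      exact (expPay_mono (fun a b => add_le_add le_rfl (hoff a b)) _ _).trans (h₂ (μ₂' []))
  · have hc₁ : ∀ h', condS μ₁ (q :: l) h' = (e q.1 q.2 (l.length + h'.length)).1 := fun h' => by
      rw [← List.length_append]; rfl
    have hc₂ : ∀ h', condS μ₂ (q :: l) h' = (e q.1 q.2 (l.length + h'.length)).2 := fun h' => by
      rw [← List.length_append]; rfl
    refine ⟨fun μ₁' => ?_, fun μ₂' => ?_⟩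
    · rw [totPay_eq (μ₁ := condS μ₁ (q :: l)) _ [] (fun t =>
        expPay u₁ (e q.1 q.2 (l.length + t)).1 (e q.1 q.2 (l.length + t)).2) fun h' _ => by
          rw [hc₁, hc₂]; rfl]
      exact totPay_le _ _ _ fun h' _ => by rw [hc₂]; exact (he q.1 q.2 _).1 _
    · rw [totPay_eq (μ₂ := condS μ₂ (q :: l)) _ [] (fun t =>
        expPay u₂ (e q.1 q.2 (l.length + t)).1 (e q.1 q.2 (l.length + t)).2) fun h' _ => by
          rw [hc₁, hc₂]; rfl]
      exact totPay_le _ _ _ fun h' _ => by rw [hc₁]; exact (he q.1 q.2 _).2 _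

theorem mem_NashMM_of_isNEmm_one {u₁ u₂ : A₁ → A₂ → ℝ} {μ₁ : Hist A₁ A₂ → Mix A₁}
    {μ₂ : Hist A₁ A₂ → Mix A₂} (h : isNEmm u₁ u₂ 1 μ₁ μ₂) : (μ₁ [], μ₂ []) ∈ NashMM u₁ u₂ := by
  refine ⟨fun τ => ?_, fun τ => ?_⟩
  · simpa [totPay, expPay] using h.1 fun _ => τ
  · simpa [totPay, expPay] using h.2 fun _ => τ

/-- A repeated game with a subgame-perfect equilibrium has a stage equilibrium: the one played in
the last round. -/
theorem NashMM_nonempty_of_isSPEmm [Nonempty A₁] [Nonempty A₂] {u₁ u₂ : A₁ → A₂ → ℝ} {T : ℕ}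
    (hT : 1 ≤ T) {μ₁ : Hist A₁ A₂ → Mix A₁} {μ₂ : Hist A₁ A₂ → Mix A₂}
    (hμ : isSPEmm u₁ u₂ T μ₁ μ₂) : (NashMM u₁ u₂).Nonempty := by
  have h := hμ (List.replicate (T - 1) Classical.ofNonempty) (by rw [List.length_replicate]; omega)
  rw [List.length_replicate, show T - (T - 1) = 1 by omega] at h
  exact ⟨_, mem_NashMM_of_isNEmm_one h⟩

/-- If player 2 has a unique equilibrium payoff and only equilibria are played after the first
round, then player 2 best responds in the first round. -/
theorem BR2m_of_isNEmm {u₁ u₂ : A₁ → A₂ → ℝ} {v : ℝ} (hv : V2mm u₁ u₂ = {v}) {n : ℕ}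
    {μ₁ : Hist A₁ A₂ → Mix A₁} {μ₂ : Hist A₁ A₂ → Mix A₂} (hNE : isNEmm u₁ u₂ (n + 1) μ₁ μ₂)
    (hN : ∀ h : Hist A₁ A₂, h ≠ [] → h.length < n + 1 → (μ₁ h, μ₂ h) ∈ NashMM u₁ u₂) :
    BR2m u₂ (μ₁ []) (μ₂ []) := by
  classical
  intro τ
  have hval : ∀ ν : Hist A₁ A₂ → Mix A₂, (∀ h, h ≠ [] → ν h = μ₂ h) → ∀ a b,
      totPay u₂ μ₁ ν n ([] ++ [(a, b)]) = ∑ _t ∈ range n, v := fun ν hν a b =>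
    totPay_eq n _ _ fun h' hh' => by
      rw [hν _ (by simp)]
      have : expPay u₂ (μ₁ ([] ++ [(a, b)] ++ h')) (μ₂ ([] ++ [(a, b)] ++ h')) ∈ V2mm u₁ u₂ :=
        ⟨_, hN _ (by simp) (by simpa using hh'), rfl⟩
      simpa only [hv, Set.mem_singleton_iff] using this
  have hdev := hNE.2 (Function.update μ₂ [] τ)
  rw [totPay_succ, totPay_succ] at hdev
  simp only [hval μ₂ fun _ _ => rfl,
    hval (Function.update μ₂ [] τ) fun h hh => Function.update_of_ne hh _ _,
    expPay_add_const, Function.update_self] at hdev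
  linarith

/-- If player 1 has a unique equilibrium payoff and only equilibria are played after the first
round, then player 1 best responds in the first round. -/
theorem BR1m_of_isNEmm {u₁ u₂ : A₁ → A₂ → ℝ} {v : ℝ} (hv : V1mm u₁ u₂ = {v}) {n : ℕ}
    {μ₁ : Hist A₁ A₂ → Mix A₁} {μ₂ : Hist A₁ A₂ → Mix A₂} (hNE : isNEmm u₁ u₂ (n + 1) μ₁ μ₂)
    (hN : ∀ h : Hist A₁ A₂, h ≠ [] → h.length < n + 1 → (μ₁ h, μ₂ h) ∈ NashMM u₁ u₂) :
    BR1m u₁ (μ₁ []) (μ₂ []) := by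
  classical
  intro τ
  have hval : ∀ ν : Hist A₁ A₂ → Mix A₁, (∀ h, h ≠ [] → ν h = μ₁ h) → ∀ a b,
      totPay u₁ ν μ₂ n ([] ++ [(a, b)]) = ∑ _t ∈ range n, v := fun ν hν a b =>
    totPay_eq n _ _ fun h' hh' => by
      rw [hν _ (by simp)]
      have : expPay u₁ (μ₁ ([] ++ [(a, b)] ++ h')) (μ₂ ([] ++ [(a, b)] ++ h')) ∈ V1mm u₁ u₂ :=
        ⟨_, hN _ (by simp) (by simpa using hh'), rfl⟩
      simpa only [hv, Set.mem_singleton_iff] using this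
  have hdev := hNE.1 (Function.update μ₁ [] τ)
  rw [totPay_succ, totPay_succ] at hdev
  simp only [hval μ₁ fun _ _ => rfl,
    hval (Function.update μ₁ [] τ) fun h hh => Function.update_of_ne hh _ _,
    expPay_add_const, Function.update_self] at hdev
  linarith

/-- Backward induction: if equilibrium play in all later rounds forces equilibrium play in the
current one, then a subgame-perfect equilibrium plays a stage equilibrium at every history. -/
theorem mem_NashMM_of_isSPEmm {u₁ u₂ : A₁ → A₂ → ℝ}
    (hstep : ∀ (n : ℕ) (ν₁ : Hist A₁ A₂ → Mix A₁) (ν₂ : Hist A₁ A₂ → Mix A₂),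
      isNEmm u₁ u₂ (n + 1) ν₁ ν₂ →
      (∀ h : Hist A₁ A₂, h ≠ [] → h.length < n + 1 → (ν₁ h, ν₂ h) ∈ NashMM u₁ u₂) →
      (ν₁ [], ν₂ []) ∈ NashMM u₁ u₂)
    {T : ℕ} {μ₁ : Hist A₁ A₂ → Mix A₁} {μ₂ : Hist A₁ A₂ → Mix A₂} (hμ : isSPEmm u₁ u₂ T μ₁ μ₂) :
    ∀ h : Hist A₁ A₂, h.length < T → (μ₁ h, μ₂ h) ∈ NashMM u₁ u₂ := by
  suffices H : ∀ (n : ℕ) (h : Hist A₁ A₂), h.length + (n + 1) = T →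
      (μ₁ h, μ₂ h) ∈ NashMM u₁ u₂ from fun h hh => H (T - h.length - 1) h (by omega)
  intro n
  induction n using Nat.strong_induction_on with
  | _ n ih =>
    intro h hh
    have hNE := hμ h (by omega)
    rw [show T - h.length = n + 1 by omega] at hNE
    have := hstep n _ _ hNE fun h' hne hlt => by
      have hpos := List.length_pos_iff.2 hne
      exact ih (n - h'.length) (by omega) (h ++ h') (by rw [List.length_append]; omega)
    simpa [condS] using this

end RepeatedGame

section Construction

variable {A₁ A₂ : Type*} [Fintype A₁] [Fintype A₂] [DecidableEq A₁] [DecidableEq A₂]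

/-- Two equilibria that differ for player 1 and two that differ for player 2 suffice to enforce
any pure stage profile. -/
theorem GLSmm_of_nontrivial {u₁ u₂ : A₁ → A₂ → ℝ} (hV₁ : (V1mm u₁ u₂).Nontrivial)
    (hV₂ : (V2mm u₁ u₂).Nontrivial) {σ₁ : Mix A₁} {σ₂ : Mix A₂} (hσ : (σ₁, σ₂) ∉ NashMM u₁ u₂) :
    GLSmm u₁ u₂ := by
  obtain ⟨a₀, b₀, hab⟩ := exists_pure_notMem_NashMM hσ
  obtain ⟨_, ⟨p, hp, rfl⟩, _, ⟨p', hp', rfl⟩, hlt₁⟩ := hV₁.exists_lt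
  obtain ⟨_, ⟨r, hr, rfl⟩, _, ⟨r', hr', rfl⟩, hlt₂⟩ := hV₂.exists_lt
  simp only at hlt₁ hlt₂
  have : Nonempty A₁ := ⟨a₀⟩
  have : Nonempty A₂ := ⟨b₀⟩
  obtain ⟨m₁, hm₁⟩ := Finite.exists_max fun x : A₁ => u₁ x b₀ - u₁ a₀ b₀
  obtain ⟨m₂, hm₂⟩ := Finite.exists_max fun x : A₂ => u₂ a₀ x - u₂ a₀ b₀
  obtain ⟨K₁, hK₁⟩ := exists_nat_gt
    ((u₁ m₁ b₀ - u₁ a₀ b₀) / (expPay u₁ p'.1 p'.2 - expPay u₁ p.1 p.2))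
  obtain ⟨K₂, hK₂⟩ := exists_nat_gt
    ((u₂ a₀ m₂ - u₂ a₀ b₀) / (expPay u₂ r'.1 r'.2 - expPay u₂ r.1 r.2))
  rw [div_lt_iff₀ (sub_pos.2 hlt₁)] at hK₁
  rw [div_lt_iff₀ (sub_pos.2 hlt₂)] at hK₂
  let e : A₁ → A₂ → ℕ → Mix A₁ × Mix A₂ := fun a b t =>
    if t < K₁ then (if a = a₀ then p' else p) else (if b = b₀ then r' else r)
  have hsum : ∀ (u : A₁ → A₂ → ℝ) a b,
      ∑ t ∈ range (K₁ + K₂), expPay u (e a b t).1 (e a b t).2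
        = K₁ * (if a = a₀ then expPay u p'.1 p'.2 else expPay u p.1 p.2)
          + K₂ * (if b = b₀ then expPay u r'.1 r'.2 else expPay u r.1 r.2) := by
    intro u a b
    rw [Finset.sum_range_add]
    congr 1
    · rw [Finset.sum_congr rfl (g := fun _ =>
        if a = a₀ then expPay u p'.1 p'.2 else expPay u p.1 p.2) fun t ht => by
          simp only [e, if_pos (Finset.mem_range.1 ht)]; split_ifs <;> rfl]
      simp
    · rw [Finset.sum_congr rfl (g := fun _ =>
        if b = b₀ then expPay u r'.1 r'.2 else expPay u r.1 r.2) fun t _ => by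
          simp only [e, if_neg (Nat.not_lt.2 (Nat.le_add_right K₁ t))]; split_ifs <;> rfl]
      simp
  refine GLSmm_of_continuation (σ₁ := Mix.pure a₀) (σ₂ := Mix.pure b₀) (K₁ + K₂) e ?_ ?_ ?_ hab
  · intro a b t
    simp only [e]
    split_ifs <;> assumption
  · refine BR1m_of_forall_pure fun a => ?_
    rw [expPay_pure_pure, expPay_pure_pure, hsum, hsum]
    by_cases ha : a = a₀
    · rw [ha]
    · simp only [ha, if_true, if_false]
      have := hm₁ a
      linarith
  · refine BR2m_of_forall_pure fun b => ?_
    rw [expPay_pure_pure, expPay_pure_pure, hsum, hsum]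
    by_cases hb : b = b₀
    · rw [hb]
    · simp only [hb, if_true, if_false]
      have := hm₂ b
      linarith

/-- The pushforward of a probability vector along a map is a mixed strategy. -/
theorem exists_mix_map {ι A : Type*} [Fintype ι] [Fintype A] (φ : ι → A) {q : ι → ℝ}
    (hq : ∀ i, 0 ≤ q i) (hq1 : ∑ i, q i = 1) :
    ∃ σ : Mix A, ∀ f : A → ℝ, ∑ a, σ.p a * f a = ∑ i, q i * f (φ i) := by
  classical
  have key : ∀ f : A → ℝ, ∑ a, (∑ i, if φ i = a then q i else 0) * f a
      = ∑ i, q i * f (φ i) := by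
    intro f
    simp only [Finset.sum_mul]
    rw [Finset.sum_comm]
    simp [ite_mul]
  exact ⟨⟨fun a => ∑ i, if φ i = a then q i else 0,
    fun a => Finset.sum_nonneg fun i _ => by split_ifs <;> simp [hq],
    by simpa [hq1] using key fun _ => 1⟩, key⟩

/-- When the equilibrium payoffs of player 1 vary and that of player 2 does not, continuation play
can make player 1 follow a vertex of the set of strategies to which a fixed action of player 2 is a
best response, with player 2 mixing among the best responses to it. -/
theorem exists_continuation {u₁ u₂ : A₁ → A₂ → ℝ} {v : ℝ} (hV₁ : (V1mm u₁ u₂).Nontrivial)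
    (hV₂ : V2mm u₁ u₂ = {v}) {σ₁ : Mix A₁} {σ₂ : Mix A₂} {a' : A₁}
    (hlt : expPay u₁ σ₁ σ₂ < expPay u₁ (Mix.pure a') σ₂) (hbr : BR2m u₂ σ₁ σ₂) :
    ∃ (τ₁ : Mix A₁) (τ₂ : Mix A₂) (N : ℕ) (e : A₁ → A₂ → ℕ → Mix A₁ × Mix A₂),
      (∀ a b t, e a b t ∈ NashMM u₁ u₂) ∧
      BR1m (fun a b => u₁ a b + ∑ t ∈ range N, expPay u₁ (e a b t).1 (e a b t).2) τ₁ τ₂ ∧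
      BR2m (fun a b => u₂ a b + ∑ t ∈ range N, expPay u₂ (e a b t).1 (e a b t).2) τ₁ τ₂ ∧
      (τ₁, τ₂) ∉ NashMM u₁ u₂ := by
  obtain ⟨b₀, hb₀, hbr₀⟩ := exists_pure_of_BR2m hlt hbr
  have hdiff : ∀ (p : A₁ → ℝ) b, ∑ a, p a * (u₂ a b - u₂ a b₀)
      = ∑ a, p a * u₂ a b - ∑ a, p a * u₂ a b₀ := fun p b => by
    rw [← Finset.sum_sub_distrib]
    exact Finset.sum_congr rfl fun a _ => mul_sub _ _ _
  obtain ⟨p, hp, hpb, hpf, hcard⟩ := exists_vertex_le (fun a b => u₂ a b - u₂ a b₀)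
    (fun a => u₁ a b₀) b₀ (fun a => sub_self _) (σ := σ₁.p) ⟨σ₁.nonneg, σ₁.sum_one⟩
    (fun b => by rw [hdiff]; exact sub_nonpos.2 (hbr₀ b))
  simp only [hdiff, sub_nonpos] at hpb
  let τ₁ : Mix A₁ := ⟨p, hp.1, hp.2⟩
  obtain ⟨i₀⟩ : Nonempty {a // p a ≠ 0} := by
    by_contra! hemp
    have : ∀ a, p a = 0 := fun a => by
      by_contra ha
      exact hemp.elim ⟨a, ha⟩
    simpa [this] using hp.2
  obtain ⟨φ', hφ'⟩ : ∃ φ' : {a // p a ≠ 0} ↪ {b // ∑ a, p a * (u₂ a b - u₂ a b₀) = 0},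
      φ' i₀ = ⟨b₀, by simp⟩ := by
    obtain ⟨ψ⟩ := Function.Embedding.nonempty_of_card_le hcard
    exact ⟨ψ.trans (Equiv.swap (ψ i₀) ⟨b₀, by simp⟩).toEmbedding, by simp⟩
  let φ : {a // p a ≠ 0} → A₂ := fun i => (φ' i).1
  have hφinj : ∀ {i j}, φ i = φ j ↔ i = j := fun {i j} =>
    ⟨fun h => φ'.injective (Subtype.ext h), fun h => by rw [h]⟩
  have hφ₀ : φ i₀ = b₀ := by simp only [φ, hφ']
  have hφbr : ∀ i, ∑ a, p a * u₂ a (φ i) = ∑ a, p a * u₂ a b₀ := fun i => by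
    have := (φ' i).2
    rw [hdiff] at this
    exact sub_eq_zero.1 this
  obtain ⟨_, ⟨x, hx, rfl⟩, _, ⟨y, hy, rfl⟩, hxy⟩ := hV₁.exists_lt
  simp only at hxy
  set δ := expPay u₁ y.1 y.2 - expPay u₁ x.1 x.2 with hδ
  have hδpos : 0 < δ := sub_pos.2 hxy
  obtain ⟨w, q, c, hq, hq1, hqc, hqd⟩ := exists_equalizing_weights (fun i j => u₁ i.1 (φ j)) hδpos
    (fun j => u₁ a' (φ j) - ∑ a, p a * u₁ a (φ j)) i₀ (by
      rw [hφ₀]; exact sub_pos.2 (hpf.trans_lt hb₀))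
  obtain ⟨τ₂, hτ₂⟩ := exists_mix_map φ hq hq1
  have : Nonempty A₁ := ⟨a'⟩
  obtain ⟨m, hm⟩ := Finite.exists_max fun a : A₁ => ∑ j, q j * u₁ a (φ j)
  obtain ⟨M, hM⟩ := exists_nat_gt ((∑ j, q j * u₁ m (φ j) - c) / δ)
  rw [div_lt_iff₀ hδpos] at hM
  let n : A₁ → A₂ → ℕ := fun a b =>
    if h : p a ≠ 0 then M + (if φ ⟨a, h⟩ = b then w ⟨a, h⟩ else 0) else 0
  let N := M + ∑ i, w i
  have hnN : ∀ a b, n a b ≤ N := by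
    intro a b
    simp only [n, N]
    split_ifs with h1 h2
    · exact Nat.add_le_add_left (Finset.single_le_sum (fun i _ => Nat.zero_le _) (mem_univ _)) _
    · omega
    · omega
  let e : A₁ → A₂ → ℕ → Mix A₁ × Mix A₂ := fun a b t => if t < n a b then y else x
  have he : ∀ a b t, e a b t ∈ NashMM u₁ u₂ := by
    intro a b t
    simp only [e]
    split_ifs <;> assumption
  have hsum : ∀ a b, ∑ t ∈ range N, expPay u₁ (e a b t).1 (e a b t).2
      = N * expPay u₁ x.1 x.2 + n a b * δ := by
    intro a b
    have h1 : ∀ t, expPay u₁ (e a b t).1 (e a b t).2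
        = expPay u₁ x.1 x.2 + if t < n a b then δ else 0 := by
      intro t
      simp only [e]
      split_ifs
      · rw [hδ]; ring
      · simp
    have h2 : (range N).filter (fun t => t < n a b) = range (n a b) := by
      ext t
      simp only [Finset.mem_filter, Finset.mem_range]
      have := hnN a b
      omega
    simp only [h1, Finset.sum_add_distrib, ← Finset.sum_filter, h2, Finset.sum_const,
      Finset.card_range, nsmul_eq_mul]
  have hpay : ∀ a, ∑ b, τ₂.p b * (u₁ a b + (N * expPay u₁ x.1 x.2 + n a b * δ))
      = ∑ j, q j * u₁ a (φ j) + N * expPay u₁ x.1 x.2 + (∑ j, q j * n a (φ j)) * δ := by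
    intro a
    rw [hτ₂]
    simp only [mul_add, Finset.sum_add_distrib, ← Finset.sum_mul, hq1, one_mul, ← mul_assoc]
    ring
  have hin : ∀ a, p a ≠ 0 → ∑ b, τ₂.p b * (u₁ a b + (N * expPay u₁ x.1 x.2 + n a b * δ))
      = N * expPay u₁ x.1 x.2 + M * δ + c := by
    intro a ha
    have h1 : ∑ j, q j * (n a (φ j) : ℝ) = M + q ⟨a, ha⟩ * w ⟨a, ha⟩ := by
      simp only [n, dif_pos ha, hφinj, Nat.cast_add, Nat.cast_ite, Nat.cast_zero, mul_add,
        Finset.sum_add_distrib, ← Finset.sum_mul, hq1, one_mul]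
      simp
    have h2 := hqc ⟨a, ha⟩
    rw [hpay, h1]
    simp only at h2
    linarith
  have hout : ∀ a, p a = 0 → ∑ b, τ₂.p b * (u₁ a b + (N * expPay u₁ x.1 x.2 + n a b * δ))
      ≤ N * expPay u₁ x.1 x.2 + M * δ + c := by
    intro a ha
    have h1 : ∑ j, q j * (n a (φ j) : ℝ) = 0 := by simp [n, ha]
    rw [hpay, h1]
    have := hm a
    linarith
  refine ⟨τ₁, τ₂, N, e, he, ?_, ?_, ?_⟩
  · intro τ
    simp only [hsum]
    rw [expPay_eq_sum_left _ τ τ₂, expPay_eq_sum_left _ τ₁ τ₂,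
      τ₁.sum_mul_eq fun a ha => hin a ha.ne']
    refine τ.sum_mul_le fun a => ?_
    by_cases ha : p a = 0
    · exact hout a ha
    · exact (hin a ha).le
  · have hval : ∀ a b t, expPay u₂ (e a b t).1 (e a b t).2 = v := fun a b t => by
      have : expPay u₂ (e a b t).1 (e a b t).2 ∈ V2mm u₁ u₂ := ⟨_, he a b t, rfl⟩
      simpa only [hV₂, Set.mem_singleton_iff] using this
    intro τ
    simp only [hval, expPay_add_const]
    rw [expPay_eq_sum_right, expPay_eq_sum_right, hτ₂]
    simp only [τ₁, hφbr, ← Finset.sum_mul, hq1, one_mul]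
    exact add_le_add (τ.sum_mul_le hpb) le_rfl
  · intro hN
    have h1 := hN.1 (Mix.pure a')
    simp only at h1
    rw [expPay_pure_left, expPay_eq_sum_right, hτ₂, hτ₂] at h1
    simp only [mul_sub, Finset.sum_sub_distrib] at hqd
    simp only [τ₁] at h1
    linarith

theorem GLSmm_of_condMM {u₁ u₂ : A₁ → A₂ → ℝ} (h : condMM u₁ u₂) : GLSmm u₁ u₂ := by
  rcases h with ⟨h₁, h₂, σ₁, σ₂, hσ⟩ | ⟨h₁, ⟨v, hv⟩, σ₁, σ₂, a', hlt, hbr⟩ |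
    ⟨⟨v, hv⟩, h₂, σ₁, σ₂, b', hlt, hbr⟩
  · exact GLSmm_of_nontrivial h₁ h₂ hσ
  · obtain ⟨τ₁, τ₂, N, e, he, hb₁, hb₂, hN⟩ := exists_continuation h₁ hv hlt hbr
    exact GLSmm_of_continuation N e he hb₁ hb₂ hN
  · rw [← V1mm_flip] at h₂
    rw [← V2mm_flip] at hv
    rw [← expPay_flip u₂, ← expPay_flip u₂] at hlt
    obtain ⟨τ₂, τ₁, N, e, he, hb₂, hb₁, hN⟩ :=
      exists_continuation h₂ hv hlt (BR2m_flip.2 hbr)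
    refine GLSmm_of_continuation N (fun a b t => (e b a t).swap)
      (fun a b t => mem_NashMM_flip.1 (he b a t)) ?_ ?_ (fun h => hN (mem_NashMM_flip.2 h))
    · rw [← BR2m_flip]
      simp only [expPay_flip] at hb₁
      exact hb₁
    · rw [← BR1m_flip]
      simp only [expPay_flip] at hb₂
      exact hb₂

theorem condMM_of_GLSmm [Nonempty A₁] [Nonempty A₂] {u₁ u₂ : A₁ → A₂ → ℝ}
    (h : GLSmm u₁ u₂) : condMM u₁ u₂ := by
  obtain ⟨T, hT, μ₁, μ₂, hμ, h₀, hlen, hbad⟩ := h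
  have hone : ∀ {V : Set ℝ}, V.Nonempty → ¬ V.Nontrivial → oneVal V := fun hne hnt =>
    Set.exists_eq_singleton_iff_nonempty_subsingleton.2 ⟨hne, Set.not_nontrivial_iff.1 hnt⟩
  obtain ⟨q, hq⟩ := NashMM_nonempty_of_isSPEmm hT hμ
  have hne₁ : (V1mm u₁ u₂).Nonempty := ⟨_, q, hq, rfl⟩
  have hne₂ : (V2mm u₁ u₂).Nonempty := ⟨_, q, hq, rfl⟩
  by_cases h₁ : (V1mm u₁ u₂).Nontrivial <;> by_cases h₂ : (V2mm u₁ u₂).Nontrivial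
  · exact Or.inl ⟨h₁, h₂, _, _, hbad⟩
  · obtain ⟨v, hv⟩ := hone hne₂ h₂
    refine Or.inr (Or.inl ⟨h₁, ⟨v, hv⟩, ?_⟩)
    by_contra! hno
    refine hbad (mem_NashMM_of_isSPEmm (fun n ν₁ ν₂ hNE hN => ?_) hμ h₀ hlen)
    have hbr := BR2m_of_isNEmm hv hNE hN
    exact ⟨BR1m_of_forall_pure fun a => not_lt.1 fun hlt => hno _ _ a hlt hbr, hbr⟩
  · obtain ⟨v, hv⟩ := hone hne₁ h₁
    refine Or.inr (Or.inr ⟨⟨v, hv⟩, h₂, ?_⟩)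
    by_contra! hno
    refine hbad (mem_NashMM_of_isSPEmm (fun n ν₁ ν₂ hNE hN => ?_) hμ h₀ hlen)
    have hbr := BR1m_of_isNEmm hv hNE hN
    exact ⟨hbr, BR2m_of_forall_pure fun b => not_lt.1 fun hlt => hno _ _ b hlt hbr⟩
  · obtain ⟨v₁, hv₁⟩ := hone hne₁ h₁
    obtain ⟨v₂, hv₂⟩ := hone hne₂ h₂
    exact absurd (mem_NashMM_of_isSPEmm (fun n ν₁ ν₂ hNE hN =>
      ⟨BR1m_of_isNEmm hv₁ hNE hN, BR2m_of_isNEmm hv₂ hNE hN⟩) hμ h₀ hlen) hbad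

end Construction

section TwoPlayer
variable {A₁ A₂ : Type*} [Fintype A₁] [Fintype A₂] [DecidableEq A₁] [DecidableEq A₂]
variable [Nonempty A₁] [Nonempty A₂]

/-- Theorem (2-player, general case): local suboptimality occurs in some SPE of some
finitely repeated game `G(T)` (both players mixed) iff the mixed-mixed condition holds. -/
theorem localSuboptimality_general_iff (u₁ u₂ : A₁ → A₂ → ℝ) :
    GLSmm u₁ u₂ ↔ condMM u₁ u₂ :=
  ⟨condMM_of_GLSmm, GLSmm_of_condMM⟩

end TwoPlayer
end
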